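/- arXiv:1102.3205 — 7 statements merged into one kernel-verified Lean document; each statement's English description precedes it below -/
import Mathlib

section
/- Let F ⊆ E be an extension of differential fields of characteristic zero such that E = F(x) is generated as a field over F by a single element x with x′ ∈ F. If E contains a constant that does not lie in F (i.e., the field of constants of E strictly contains the field of constants of F), then there exists y ∈ F with y′ = x′. -/
namespace Differential

open Polynomial

section ImplicitDeriv

variable {F : Type*} [Field F] [Differential F]

lemma coeff_implicitDeriv_C (v : F) (p : F[X]) (n : ℕ) :
    (implicitDeriv (C v) p).coeff n = (p.coeff n)′ + v * (p.coeff (n + 1) * (n + 1)) := by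
  simp [implicitDeriv, coeff_derivative]

lemma degree_implicitDeriv_C_lt (v : F) {p : F[X]} (hp : p.Monic) :
    (implicitDeriv (C v) p).degree < p.degree := by
  rw [degree_eq_natDegree hp.ne_zero, degree_lt_iff_coeff_zero]
  intro m hm
  rw [coeff_implicitDeriv_C, coeff_eq_zero_of_natDegree_lt (Nat.lt_succ_of_le hm)]
  rcases hm.eq_or_lt with rfl | hlt
  · simp [hp.coeff_natDegree]
  · simp [coeff_eq_zero_of_natDegree_lt hlt]

/-- A nonconstant polynomial killed by the derivation `X′ = v` yields an antiderivative of `v`,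
namely minus the quotient of its two top coefficients divided by its degree. -/
lemma exists_deriv_eq_of_implicitDeriv_C_eq_zero [CharZero F] {v : F} {p : F[X]}
    (hdeg : p.natDegree ≠ 0) (hp : implicitDeriv (C v) p = 0) : ∃ y : F, y′ = v := by
  obtain ⟨n, hn⟩ := Nat.exists_eq_succ_of_ne_zero hdeg
  have hlead : p.coeff (n + 1) ≠ 0 := by
    rw [← Nat.succ_eq_add_one, ← hn, coeff_natDegree, leadingCoeff_ne_zero]
    rintro rfl
    simp at hdeg
  have hn0 : ((n : F) + 1) ≠ 0 := by exact_mod_cast n.succ_ne_zero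
  have htop : (p.coeff (n + 1))′ = 0 := by
    have h := coeff_implicitDeriv_C v p (n + 1)
    rw [hp, coeff_eq_zero_of_natDegree_lt (n := n + 1 + 1) (by omega)] at h
    simpa using h.symm
  have hnext := coeff_implicitDeriv_C v p n
  rw [hp, coeff_zero] at hnext
  have hconst : (p.coeff (n + 1) * ((n : F) + 1))′ = 0 := by
    simp [htop]
  refine ⟨-p.coeff n / (p.coeff (n + 1) * (n + 1)), ?_⟩
  rw [Derivation.leibniz_div, hconst, map_neg, eq_neg_of_add_eq_zero_left hnext.symm]
  simp only [smul_eq_mul]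
  field_simp
  ring

end ImplicitDeriv

section Extension

variable {F E : Type*} [Field F] [CharZero F] [Differential F] [Field E] [Differential E]
  [Algebra F E] [DifferentialAlgebra F E] {x : E} {v : F}

lemma exists_deriv_eq_of_isAlgebraic (hx : x′ = algebraMap F E v) (halg : IsAlgebraic F x) :
    ∃ y : F, y′ = v := by
  have hmonic := minpoly.monic halg.isIntegral
  refine exists_deriv_eq_of_implicitDeriv_C_eq_zero (p := minpoly F x)
    (minpoly.natDegree_pos halg.isIntegral).ne' ?_
  by_contra hne
  refine (minpoly.degree_le_of_ne_zero F x hne ?_).not_gt (degree_implicitDeriv_C_lt v hmonic)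
  rw [← deriv_aeval_eq_implicitDeriv x (C v) (by simpa using hx)]
  simp

lemma exists_deriv_eq_of_transcendental (hx : x′ = algebraMap F E v) (htr : Transcendental F x)
    {c : E} (hc : c′ = 0) (hcF : c ∉ Set.range (algebraMap F E)) (p q : F[X]) (hq : q ≠ 0)
    (hpq : aeval x p = c * aeval x q) : ∃ y : F, y′ = v := by
  induction hd : q.degree using WellFoundedLT.induction generalizing p q with
  | ind d ih =>
  subst hd
  wlog hmonic : q.Monic generalizing p q
  · refine this (C q.leadingCoeff⁻¹ * p) (q * C q.leadingCoeff⁻¹)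
      (monic_mul_leadingCoeff_inv hq).ne_zero ?_ ?_ (monic_mul_leadingCoeff_inv hq)
    · simp only [map_mul, hpq]
      ring
    · rwa [degree_mul_leadingCoeff_inv q hq]
  have hderiv (r : F[X]) : (aeval x r)′ = aeval x (implicitDeriv (C v) r) :=
    deriv_aeval_eq_implicitDeriv x (C v) (by simpa using hx) r
  have hpq' : aeval x (implicitDeriv (C v) p) = c * aeval x (implicitDeriv (C v) q) := by
    rw [← hderiv, ← hderiv, hpq]
    simp [hc]
  by_cases hq0 : implicitDeriv (C v) q = 0
  · by_cases hqdeg : q.natDegree = 0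
    · refine exists_deriv_eq_of_implicitDeriv_C_eq_zero (p := p) (fun hpdeg ↦ hcF ?_) ?_
      · rw [hmonic.natDegree_eq_zero.mp hqdeg, eq_C_of_natDegree_eq_zero hpdeg] at hpq
        exact ⟨p.coeff 0, by simpa using hpq⟩
      · rw [hq0, map_zero, mul_zero] at hpq'
        exact (transcendental_iff.mp htr) _ hpq'
    · exact exists_deriv_eq_of_implicitDeriv_C_eq_zero hqdeg hq0
  · exact ih _ (degree_implicitDeriv_C_lt v hmonic) _ _ hq0 hpq' rfl

open scoped IntermediateField in
/-- If `F⟮x⟯` with `x′ = v ∈ F` contains a constant outside `F`, then `v` has an antiderivative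
in `F`. -/
lemma exists_deriv_eq_of_mem_adjoin_simple (hx : x′ = algebraMap F E v) {c : E} (hcx : c ∈ F⟮x⟯)
    (hc : c′ = 0) (hcF : c ∉ Set.range (algebraMap F E)) : ∃ y : F, y′ = v := by
  by_cases halg : IsAlgebraic F x
  · exact exists_deriv_eq_of_isAlgebraic hx halg
  obtain ⟨p, q, rfl⟩ := (IntermediateField.mem_adjoin_simple_iff F c).mp hcx
  have hq : aeval x q ≠ 0 := fun h ↦ hcF ⟨0, by simp [h]⟩
  exact exists_deriv_eq_of_transcendental hx halg hc hcF p q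
    (fun h ↦ hq (by simp [h])) (div_mul_cancel₀ _ hq).symm

end Extension

end Differential

/-- Let `F ⊆ E` be an extension of differential fields of characteristic
zero such that `E = F(x)` is generated as a field over `F` by a single element `x` with
`x′ ∈ F`.  If `E` contains a constant that does not lie in `F`, then there exists `y ∈ F`
with `y′ = x′`. -/
theorem new_constant_of_antiderivative
    (E : Type) [Field E] [CharZero E] (D : Derivation ℚ E E)
    (F : Subfield E) (hF : ∀ a ∈ F, D a ∈ F)
    (x : E) (hx : D x ∈ F)
    (hgen : Subfield.closure (↑F ∪ {x}) = ⊤)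
    (hnew : ∃ c : E, D c = 0 ∧ c ∉ F) :
    ∃ y ∈ F, D y = D x := by
  obtain ⟨c, hc, hcF⟩ := hnew
  let : Differential E := ⟨D.restrictScalars ℤ⟩
  let : Differential F :=
    ⟨Derivation.mk' (((D.restrictScalars ℤ : E →ₗ[ℤ] E).comp
        F.toAddSubgroup.subtype.toIntLinearMap).codRestrict
          F.toAddSubgroup.toIntSubmodule fun a ↦ hF a a.2)
      fun a b ↦ Subtype.ext (D.leibniz a b)⟩
  have : DifferentialAlgebra F E := ⟨fun _ ↦ rfl⟩
  have hcx : c ∈ IntermediateField.adjoin F {x} := by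
    have hrange : Set.range (algebraMap F E) = F := Subtype.range_coe
    change c ∈ Subfield.closure (Set.range (algebraMap F E) ∪ {x})
    rw [hrange, hgen]
    trivial
  obtain ⟨y, hy⟩ := Differential.exists_deriv_eq_of_mem_adjoin_simple (F := F) (x := x)
    (v := ⟨D x, hx⟩) rfl hcx hc (by rintro ⟨a, rfl⟩; exact hcF a.2)
  exact ⟨y, y.2, congrArg Subtype.val hy⟩
end

section
/- Let F ⊆ E be an extension of differential fields of characteristic zero with the same field of constants C, and let x₁, …, xₙ ∈ E satisfy xᵢ′ ∈ F for each i. Then either x₁, …, xₙ are algebraically independent over F, or there exists a tuple (c₁, …, cₙ) ∈ Cⁿ, not all zero, such that Σᵢ cᵢ xᵢ ∈ F. -/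
open MvPolynomial

namespace MvPolynomial

section PDeriv

variable {σ R : Type*} [CommRing R]

theorem pderiv_comm (i j : σ) (p : MvPolynomial σ R) :
    pderiv i (pderiv j p) = pderiv j (pderiv i p) := by
  classical
  by_cases hij : i = j
  · rw [hij]
  ext m
  simp only [coeff_pderiv, Finsupp.add_apply, Finsupp.single_apply, if_neg hij,
    if_neg (Ne.symm hij), add_zero, add_right_comm m (Finsupp.single j 1)]
  ring

/-- Partial differentiation lowers the total degree of a nonconstant polynomial. -/
theorem totalDegree_pderiv_lt (i : σ) {p : MvPolynomial σ R} (hp : p.totalDegree ≠ 0) :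
    (pderiv i p).totalDegree < p.totalDegree := by
  rw [totalDegree, Finset.sup_lt_iff (by simpa [pos_iff_ne_zero] using hp)]
  intro m hm
  rw [mem_support_iff, coeff_pderiv] at hm
  have hle := le_totalDegree (mem_support_iff.2 (left_ne_zero_of_mul hm))
  rw [Finsupp.sum_add_index' (by simp) (by simp)] at hle
  rw [Finsupp.sum_single_index rfl] at hle
  exact hle

/-- In characteristic zero, a polynomial all of whose partial derivatives vanish is constant. -/
theorem eq_C_of_pderiv_eq_zero [NoZeroDivisors R] [CharZero R] {p : MvPolynomial σ R}
    (hp : ∀ i, pderiv i p = 0) : p = C (coeff 0 p) := by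
  classical
  ext m
  rw [coeff_C]
  split_ifs with hm
  · rw [hm]
  obtain ⟨i, hi⟩ : ∃ i, m i ≠ 0 := by
    by_contra! h
    exact hm (Finsupp.ext fun i => (h i).symm)
  have hle : Finsupp.single i 1 ≤ m := by
    simpa [Finsupp.single_le_iff] using Nat.one_le_iff_ne_zero.2 hi
  have hcoeff := congrArg (coeff (m - Finsupp.single i 1)) (hp i)
  rw [coeff_pderiv, tsub_add_cancel_of_le hle, coeff_zero] at hcoeff
  exact (mul_eq_zero.1 hcoeff).resolve_right (Nat.cast_add_one_ne_zero _)

end PDeriv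

section TotalDeriv

variable {σ R : Type*} [CommRing R]

/-- The additive map applying a derivation to each coefficient of a polynomial. -/
noncomputable def derivCoeffs (d : Derivation ℤ R R) :
    MvPolynomial σ R →+ MvPolynomial σ R :=
  AddMonoidHom.mk' (fun p => ∑ m ∈ p.support, monomial m (d (coeff m p))) <| by
    classical
    have key (p : MvPolynomial σ R) (k : σ →₀ ℕ) :
        coeff k (∑ m ∈ p.support, monomial m (d (coeff m p))) = d (coeff k p) := by
      simp +contextual [coeff_sum, coeff_monomial]
    intro p q
    ext k
    rw [key, coeff_add, coeff_add, key, key, map_add]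

@[simp]
theorem coeff_derivCoeffs (d : Derivation ℤ R R) (p : MvPolynomial σ R) (k : σ →₀ ℕ) :
    coeff k (derivCoeffs d p) = d (coeff k p) := by
  classical
  simp +contextual [derivCoeffs, coeff_sum, coeff_monomial]

variable [Fintype σ]

/-- The derivation of `R[X]` extending `d` and sending each `X i` to `a i`, as an additive map. -/
noncomputable def totalDeriv (d : Derivation ℤ R R) (a : σ → R) :
    MvPolynomial σ R →+ MvPolynomial σ R where
  toFun p := derivCoeffs d p + ∑ i, C (a i) * pderiv i p
  map_zero' := by simp
  map_add' p q := by
    simp only [map_add, mul_add, Finset.sum_add_distrib]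
    abel

theorem totalDeriv_apply (d : Derivation ℤ R R) (a : σ → R) (p : MvPolynomial σ R) :
    totalDeriv d a p = derivCoeffs d p + ∑ i, C (a i) * pderiv i p :=
  rfl

theorem totalDeriv_C (d : Derivation ℤ R R) (a : σ → R) (r : R) :
    totalDeriv d a (C r) = C (d r) := by
  classical
  ext m
  simp [totalDeriv_apply, coeff_C, apply_ite d]

theorem totalDeriv_mul_X (d : Derivation ℤ R R) (a : σ → R) (p : MvPolynomial σ R) (j : σ) :
    totalDeriv d a (p * X j) = totalDeriv d a p * X j + C (a j) * p := by
  classical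
  have hcoeffs : derivCoeffs d (p * X j) = derivCoeffs d p * X j := by
    ext m
    simp [coeff_mul_X', apply_ite d]
  simp only [totalDeriv_apply, hcoeffs, pderiv_mul, pderiv_X, Pi.single_apply, mul_add,
    Finset.sum_add_distrib, mul_ite, mul_one, mul_zero, add_mul, Finset.sum_mul, mul_assoc]
  simp [add_assoc]

theorem pderiv_totalDeriv (d : Derivation ℤ R R) (a : σ → R) (i : σ) (p : MvPolynomial σ R) :
    pderiv i (totalDeriv d a p) = totalDeriv d a (pderiv i p) := by
  have hcoeffs : pderiv i (derivCoeffs d p) = derivCoeffs d (pderiv i p) := by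
    ext m
    simp only [coeff_pderiv, coeff_derivCoeffs, Derivation.leibniz, map_add,
      Derivation.map_natCast, Derivation.map_one_eq_zero]
    simp [mul_comm]
  simp [totalDeriv_apply, hcoeffs, pderiv_comm i]

theorem aeval_totalDeriv {E : Type*} [CommRing E] [Algebra R E] {d : Derivation ℤ R R}
    {D : Derivation ℤ E E} (hD : ∀ r, D (algebraMap R E r) = algebraMap R E (d r))
    {x : σ → E} {a : σ → R} (hx : ∀ i, D (x i) = algebraMap R E (a i)) (p : MvPolynomial σ R) :
    aeval x (totalDeriv d a p) = D (aeval x p) := by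
  induction p using MvPolynomial.induction_on with
  | C r => simp [totalDeriv_C, hD]
  | add p q hp hq => simp [hp, hq]
  | mul_X p i hp =>
    simp only [totalDeriv_mul_X, map_add, map_mul, hp, aeval_X, aeval_C, Derivation.leibniz, hx,
      smul_eq_mul]
    ring

/-- The total derivative of a monic polynomial has smaller leading monomial. -/
theorem degree_totalDeriv_lt (m : MonomialOrder σ) (d : Derivation ℤ R R) (a : σ → R)
    {p : MvPolynomial σ R} (hp : m.Monic p) (hne : totalDeriv d a p ≠ 0) :
    m.toSyn (m.degree (totalDeriv d a p)) < m.toSyn (m.degree p) := by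
  have hcoeff := m.coeff_degree_ne_zero_iff.2 hne
  set e := m.degree (totalDeriv d a p)
  by_contra! hle
  have hzero (i : σ) : coeff (e + Finsupp.single i 1) p = 0 := by
    refine m.coeff_eq_zero_of_lt (hle.trans_lt ?_)
    rw [map_add]
    exact lt_add_of_pos_right _ (m.toSyn_lt_iff_ne_zero.2 (by simp))
  apply hcoeff
  rw [totalDeriv_apply]
  simp only [coeff_add, coeff_derivCoeffs, coeff_sum, coeff_C_mul, coeff_pderiv, hzero]
  rcases hle.eq_or_lt with heq | hlt
  · rw [← m.toSyn.injective heq, hp.coeff_degree]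
    simp
  · rw [m.coeff_eq_zero_of_lt hlt]
    simp

end TotalDeriv

section Field

variable {σ K : Type*} [Field K] [Fintype σ]

/-- A nonzero ideal of a polynomial ring stable under a total derivative contains a nonzero
polynomial whose total derivative vanishes. -/
theorem exists_mem_totalDeriv_eq_zero (m : MonomialOrder σ) (d : Derivation ℤ K K) (a : σ → K)
    {I : Ideal (MvPolynomial σ K)} (hI : I ≠ ⊥) (hstable : ∀ p ∈ I, totalDeriv d a p ∈ I) :
    ∃ p ∈ I, p ≠ 0 ∧ totalDeriv d a p = 0 := by
  obtain ⟨p₀, hp₀, hne₀⟩ := Submodule.exists_mem_ne_zero_of_ne_bot hI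
  obtain ⟨p, ⟨hp, hne⟩, hmin⟩ := (InvImage.wf (fun p => m.toSyn (m.degree p))
    wellFounded_lt).has_min {p : MvPolynomial σ K | p ∈ I ∧ p ≠ 0} ⟨p₀, hp₀, hne₀⟩
  have hlc : m.leadingCoeff p ≠ 0 := m.leadingCoeff_ne_zero_iff.2 hne
  set q := C (m.leadingCoeff p)⁻¹ * p with hq
  have hdeg : m.degree q = m.degree p := by
    rw [hq, m.degree_mul (by simpa using hlc) hne, m.degree_C, zero_add]
  have hmonic : m.Monic q := by
    rw [MonomialOrder.Monic, MonomialOrder.leadingCoeff, hdeg, hq, coeff_C_mul]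
    exact inv_mul_cancel₀ hlc
  have hqI : q ∈ I := I.mul_mem_left _ hp
  refine ⟨q, hqI, hmonic.ne_zero, ?_⟩
  by_contra hder
  refine hmin _ ⟨hstable q hqI, hder⟩ ?_
  have hlt := degree_totalDeriv_lt m d a hmonic hder
  rwa [hdeg] at hlt

/-- If a nonconstant polynomial has zero total derivative, then so does some nonconstant
polynomial of degree one. -/
theorem exists_linear_totalDeriv_eq_zero [CharZero K] (d : Derivation ℤ K K) (a : σ → K)
    {p : MvPolynomial σ K} (hp : p.totalDegree ≠ 0) (hder : totalDeriv d a p = 0) :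
    ∃ (c : σ → K) (b : K), c ≠ 0 ∧ (∀ i, d (c i) = 0) ∧
      totalDeriv d a (∑ i, C (c i) * X i + C b) = 0 := by
  classical
  induction hn : p.totalDegree using Nat.strong_induction_on generalizing p with
  | _ n ih =>
  by_cases hex : ∃ i, (pderiv i p).totalDegree ≠ 0
  · obtain ⟨i, hi⟩ := hex
    refine ih _ (hn ▸ totalDegree_pderiv_lt i hp) hi ?_ rfl
    rw [← pderiv_totalDeriv, hder, map_zero]
  push Not at hex
  choose c hc using fun i => (⟨_, totalDegree_eq_zero_iff_eq_C.1 (hex i)⟩ :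
    ∃ r, pderiv i p = C r)
  have hlin := eq_C_of_pderiv_eq_zero (p := p - ∑ i, C (c i) * X i) fun i => by
    simp [hc, pderiv_X, Pi.single_apply]
  refine ⟨c, _, ?_, fun i => ?_, by rw [← hlin, add_sub_cancel, hder]⟩
  · rintro rfl
    refine hp (totalDegree_eq_zero_iff_eq_C.2 (eq_C_of_pderiv_eq_zero fun i => ?_))
    simp [hc]
  · apply C_injective σ K
    rw [← totalDeriv_C d a, ← hc, ← pderiv_totalDeriv, hder, map_zero, map_zero]

/-- The **Kolchin–Ostrowski theorem** for antiderivatives. -/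
theorem algebraicIndependent_or_exists_constants (m : MonomialOrder σ) [CharZero K] {E : Type*}
    [Field E] [Algebra K E] {d : Derivation ℤ K K} {D : Derivation ℤ E E}
    (hD : ∀ r, D (algebraMap K E r) = algebraMap K E (d r))
    (hconst : ∀ e, D e = 0 → e ∈ (algebraMap K E).range)
    {x : σ → E} {a : σ → K} (hx : ∀ i, D (x i) = algebraMap K E (a i)) :
    AlgebraicIndependent K x ∨ ∃ c : σ → K, c ≠ 0 ∧ (∀ i, d (c i) = 0) ∧
      ∑ i, algebraMap K E (c i) * x i ∈ (algebraMap K E).range := by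
  refine or_iff_not_imp_left.2 fun hdep => ?_
  obtain ⟨p, hp, hne, hder⟩ := exists_mem_totalDeriv_eq_zero m d a
    (I := RingHom.ker (aeval x : MvPolynomial σ K →ₐ[K] E))
    (fun hbot => hdep ((RingHom.injective_iff_ker_eq_bot _).2 hbot))
    (fun p hp => by
      rw [RingHom.mem_ker] at hp ⊢
      rw [aeval_totalDeriv hD hx, hp, map_zero])
  have hdeg : p.totalDegree ≠ 0 := fun h => by
    rw [totalDegree_eq_zero_iff_eq_C.1 h, RingHom.mem_ker, aeval_C, map_eq_zero] at hp
    exact hne (by rw [totalDegree_eq_zero_iff_eq_C.1 h, hp, map_zero])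
  obtain ⟨c, b, hc, hdc, hlin⟩ := exists_linear_totalDeriv_eq_zero d a hdeg hder
  refine ⟨c, hc, hdc, ?_⟩
  have hmem := hconst (aeval x (∑ i, C (c i) * X i + C b)) (by
    rw [← aeval_totalDeriv hD hx, hlin, map_zero])
  simpa using sub_mem hmem ⟨b, rfl⟩

end Field

end MvPolynomial

/-- The restriction of a derivation to a subfield that it preserves. -/
def Derivation.restrictSubfield {E : Type*} [Field E] [Algebra ℚ E] (D : Derivation ℚ E E)
    (F : Subfield E) (hF : ∀ a ∈ F, D a ∈ F) : Derivation ℤ F F :=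
  Derivation.mk'
    (AddMonoidHom.mk' (fun a : F => (⟨D a, hF a a.2⟩ : F))
      fun a b => Subtype.ext (by simp)).toIntLinearMap
    fun a b => Subtype.ext (by simp)

/-- Kolchin–Ostrowski, special case.  Let `F ⊆ E` be an extension of
differential fields of characteristic zero with the same field of constants, and let
`x₁, …, xₙ ∈ E` satisfy `xᵢ′ ∈ F`.  Then either the `xᵢ` are algebraically independent
over `F`, or there is a nonzero tuple of constants `(c₁, …, cₙ)` with `Σ cᵢ xᵢ ∈ F`. -/
theorem algebraicIndependent_or_constant_combination
    (E : Type) [Field E] [CharZero E] (D : Derivation ℚ E E)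
    (F : Subfield E) (hF : ∀ a ∈ F, D a ∈ F)
    (hC : ∀ c : E, D c = 0 → c ∈ F)
    (n : ℕ) (x : Fin n → E) (hx : ∀ i, D (x i) ∈ F) :
    AlgebraicIndependent F x ∨
      ∃ c : Fin n → E, (∀ i, D (c i) = 0) ∧ c ≠ 0 ∧ (∑ i, c i * x i) ∈ F := by
  have := algebraicIndependent_or_exists_constants (MonomialOrder.lex (σ := Fin n))
    (d := D.restrictSubfield F hF) (D := D.restrictScalars ℤ) (x := x)
    (a := fun i => ⟨D (x i), hx i⟩) (fun _ => rfl) (fun e he => ⟨⟨e, hC e he⟩, rfl⟩)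
    (fun _ => rfl)
  refine this.imp id ?_
  rintro ⟨c, hc, hdc, ⟨b, hb⟩⟩
  refine ⟨fun i => c i, fun i => congrArg Subtype.val (hdc i), fun h => hc ?_, ?_⟩
  · exact funext fun i => Subtype.ext (congrFun h i)
  · exact hb ▸ b.2
end

section
/- Let F be a differential field of characteristic zero with field of constants C, and let f₁, …, fₙ ∈ F satisfy condition (C). Let F ⊆ E be an extension of differential fields such that E = F(x₁, …, xₙ) for elements x₁, …, xₙ ∈ E which are algebraically independent over F and satisfy xᵢ′ = fᵢ for each i. Then every constant of E lies in C; that is, E is a no new constants extension of F. -/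
open Polynomial IntermediateField
open scoped Differential

section AntiderivativeSimple

variable {K : Type*} [Field K] [Differential K]

theorem coeff_implicitDeriv_C (f : K) (p : K[X]) (i : ℕ) :
    (Differential.implicitDeriv (C f) p).coeff i =
      (p.coeff i)′ + f * (p.coeff (i + 1) * (i + 1)) := by
  simp [Differential.implicitDeriv, coeff_derivative]

variable {f : K}

/-- A constant multiple of a non-derivative is a derivative only if the multiplier is zero. -/
theorem eq_zero_of_deriv_add_mul_eq_zero (hf : ∀ u : K, u′ ≠ f) {a c : K} (hc : c′ = 0)
    (h : a′ + f * c = 0) : c = 0 := by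
  by_contra hc0
  apply hf (-a * c⁻¹)
  have hinv : (c⁻¹)′ = 0 := by
    rw [Derivation.leibniz_inv, hc, smul_zero]
  rw [Derivation.leibniz, hinv, smul_zero, zero_add, map_neg, smul_eq_mul]
  field_simp
  linear_combination -h

theorem deriv_natCast_mul (n : ℕ) {c : K} (hc : c′ = 0) : (c * n)′ = 0 := by
  simp [Derivation.leibniz, hc]

variable [CharZero K]

/-- If `f` is not a derivative, the only monic polynomial dividing its own derivative (for the
derivation with `X′ = f`) is `1`. -/
theorem eq_one_of_monic_of_dvd_implicitDeriv (hf : ∀ u : K, u′ ≠ f) {q : K[X]} (hq : q.Monic)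
    (hdvd : q ∣ Differential.implicitDeriv (C f) q) : q = 1 := by
  have hdeg : (Differential.implicitDeriv (C f) q).degree < q.degree := by
    rw [degree_eq_natDegree hq.ne_zero, degree_lt_iff_coeff_zero]
    intro m hm
    rw [coeff_implicitDeriv_C, coeff_eq_zero_of_natDegree_lt (Nat.lt_succ_of_le hm)]
    rcases hm.eq_or_lt with rfl | hlt
    · simp [hq.coeff_natDegree]
    · simp [coeff_eq_zero_of_natDegree_lt hlt]
  have hzero := eq_zero_of_dvd_of_degree_lt hdvd hdeg
  rw [← hq.natDegree_eq_zero]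
  by_contra hn
  obtain ⟨m, hm⟩ := Nat.exists_eq_succ_of_ne_zero hn
  have hlead : q.coeff (m + 1) = 1 := by rw [← Nat.succ_eq_add_one, ← hm, hq.coeff_natDegree]
  have h := coeff_implicitDeriv_C f q m
  rw [hzero, coeff_zero, hlead, one_mul] at h
  have := eq_zero_of_deriv_add_mul_eq_zero hf (c := (m : K) + 1)
    (by simp) h.symm
  exact Nat.cast_add_one_ne_zero m this

/-- If `f` is not a derivative, a polynomial whose derivative (for `X′ = f`) is a scalar is affine
with constant leading coefficient. -/
theorem exists_eq_of_implicitDeriv_eq_C (hf : ∀ u : K, u′ ≠ f) {p : K[X]} {b : K}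
    (hp : Differential.implicitDeriv (C f) p = C b) :
    ∃ c h : K, c′ = 0 ∧ p = C c * X + C h := by
  have key (i : ℕ) : (p.coeff (i + 1))′ + f * (p.coeff (i + 2) * ((i + 1 : ℕ) + 1)) = 0 := by
    rw [← coeff_implicitDeriv_C, hp, coeff_C_succ]
  have hdeg : p.natDegree ≤ 1 := by
    by_contra! hlt
    obtain ⟨m, hm⟩ := Nat.exists_eq_add_of_le' hlt
    have hlead : p.coeff (m + 2) ≠ 0 := by
      rw [← hm, coeff_natDegree, Ne, leadingCoeff_eq_zero]
      rintro rfl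
      simp at hlt
    have hconst : (p.coeff (m + 2))′ = 0 := by
      have h := key (m + 1)
      rwa [coeff_eq_zero_of_natDegree_lt (n := m + 1 + 2) (by lia), zero_mul, mul_zero,
        add_zero] at h
    have h := key m
    have := eq_zero_of_deriv_add_mul_eq_zero hf
      (by exact_mod_cast deriv_natCast_mul (m + 1 + 1) hconst) h
    exact mul_ne_zero hlead (Nat.cast_add_one_ne_zero (m + 1)) this
  refine ⟨p.coeff 1, p.coeff 0, ?_, eq_X_add_C_of_natDegree_le_one hdeg⟩
  have h := key 0
  rwa [coeff_eq_zero_of_natDegree_lt (n := 0 + 2) (by lia), zero_mul, mul_zero, add_zero] at h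

variable {E : Type*} [Field E] [Differential E] [Algebra K E] [DifferentialAlgebra K E]

/-- Let `x` be transcendental over `K` with `x′ = f ∈ K` not a derivative in `K`. Then any
`g ∈ K(x)` with `g′ ∈ K` has the form `c x + h` with `c` a constant of `K` and `h ∈ K`. -/
theorem exists_eq_of_mem_adjoin_simple_of_deriv_eq (hf : ∀ u : K, u′ ≠ f) {x : E}
    (hx : Transcendental K x) (hxf : x′ = algebraMap K E f) {g : E} (hg : g ∈ K⟮x⟯) {b : K}
    (hgb : g′ = algebraMap K E b) :
    ∃ c h : K, c′ = 0 ∧ g = algebraMap K E c * x + algebraMap K E h := by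
  have hinj := transcendental_iff_injective.mp hx
  have haeval (p : K[X]) : (aeval x p)′ = aeval x (Differential.implicitDeriv (C f) p) :=
    Differential.deriv_aeval_eq_implicitDeriv x (C f) (by rw [aeval_C, hxf]) p
  obtain ⟨p, q, hq, hcop, hgq⟩ : ∃ p q : K[X], q.Monic ∧ IsCoprime p q ∧
      g * aeval x q = aeval x p := by
    obtain ⟨r, s, rfl⟩ := (mem_adjoin_simple_iff K _).mp hg
    by_cases hs : s = 0
    · exact ⟨0, 1, monic_one, isCoprime_one_right, by simp [hs]⟩
    obtain ⟨q, p, d, hrel, rfl, rfl⟩ := UniqueFactorizationMonoid.exists_reduced_factors s hs r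
    obtain ⟨hd, hq⟩ := mul_ne_zero_iff.mp hs
    have hunit : IsUnit (C q.leadingCoeff⁻¹) :=
      isUnit_C.mpr (inv_ne_zero (leadingCoeff_ne_zero.mpr hq)).isUnit
    have hd' : aeval x d ≠ 0 := (map_ne_zero_iff _ hinj).mpr hd
    have hq' : aeval x q ≠ 0 := (map_ne_zero_iff _ hinj).mpr hq
    refine ⟨p * C q.leadingCoeff⁻¹, q * C q.leadingCoeff⁻¹, monic_mul_leadingCoeff_inv hq,
      (isCoprime_mul_unit_right hunit p q).mpr hrel.symm.isCoprime, ?_⟩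
    simp only [map_mul]
    field_simp
  have hE : Differential.implicitDeriv (C f) p * q - p * Differential.implicitDeriv (C f) q =
      C b * q ^ 2 := by
    apply hinj
    have h := congrArg Differential.deriv hgq
    rw [Derivation.leibniz, haeval, haeval, hgb] at h
    simp only [smul_eq_mul] at h
    simp only [map_sub, map_mul, map_pow, aeval_C, ← h, ← hgq]
    ring
  have hdvd : q ∣ Differential.implicitDeriv (C f) q := by
    refine hcop.symm.dvd_of_dvd_mul_left
      ⟨Differential.implicitDeriv (C f) p - C b * q, ?_⟩
    linear_combination -hE
  obtain rfl := eq_one_of_monic_of_dvd_implicitDeriv hf hq hdvd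
  obtain ⟨c, h, hc, rfl⟩ := exists_eq_of_implicitDeriv_eq_C hf (p := p) (b := b)
    (by simpa using hE)
  exact ⟨c, h, hc, by simpa using hgq⟩

end AntiderivativeSimple

section Antiderivatives

variable {E : Type*} [Field E] [Differential E]

/-- The differential structure on an intermediate field stable under the derivation. -/
abbrev IntermediateField.differentialOfDerivMem {F : Type*} [Field F] [Algebra F E]
    (K : IntermediateField F E) (hK : ∀ a ∈ K, a′ ∈ K) : Differential K where
  deriv := Derivation.mk'
    { toFun := fun a ↦ ⟨(a : E)′, hK a a.2⟩
      map_add' := fun a b ↦ Subtype.ext (by simp)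
      map_smul' := fun n a ↦ Subtype.ext (by simp) }
    fun a b ↦ Subtype.ext (by simp)

theorem IntermediateField.deriv_mem_adjoin {F : Type*} [Field F] [Differential F] [Algebra F E]
    [DifferentialAlgebra F E] {S : Set E} (hS : ∀ y ∈ S, y′ ∈ adjoin F S) {a : E}
    (ha : a ∈ adjoin F S) : a′ ∈ adjoin F S := by
  induction ha using adjoin_induction with
  | mem y hy => exact hS y hy
  | algebraMap y => rw [deriv_algebraMap]; exact IntermediateField.algebraMap_mem _ _
  | add y z _ _ hy hz => rw [map_add]; exact add_mem hy hz
  | inv y hy hy' =>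
    rw [Derivation.leibniz_inv, smul_eq_mul]
    exact mul_mem (neg_mem (pow_mem (inv_mem hy) 2)) hy'
  | mul y z hy hz hy' hz' =>
    rw [Derivation.leibniz, smul_eq_mul, smul_eq_mul]
    exact add_mem (mul_mem hy hz') (mul_mem hz hy')

variable {F : Type*} [Field F] [CharZero F] [Differential F] [Algebra F E]
  [DifferentialAlgebra F E] {ι : Type*} [Fintype ι] {f : ι → F} {x : ι → E}

/-- Let `x` be algebraically independent antiderivatives of `f`, where no nontrivial constant linear
combination of `f` is a derivative in `F`. An element of `F(xᵢ : i ∈ s)` whose derivative lies in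
`F` is a constant linear combination of the `xᵢ`, `i ∈ s`, plus an element of `F`. -/
theorem exists_eq_sum_of_mem_adjoin_of_deriv_eq
    (hf : ∀ (c : ι → F) (g : F), (∀ i, (c i)′ = 0) → ∑ i, c i * f i = g′ → ∀ i, c i = 0)
    (hx : AlgebraicIndependent F x) (hxf : ∀ i, (x i)′ = algebraMap F E (f i)) (s : Finset ι)
    {g : E} (hg : g ∈ adjoin F (x '' s)) {b : F} (hgb : g′ = algebraMap F E b) :
    ∃ (c : ι → F) (h : F), (∀ i, (c i)′ = 0) ∧ (∀ i ∉ s, c i = 0) ∧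
      g = ∑ i, algebraMap F E (c i) * x i + algebraMap F E h := by
  classical
  induction s using Finset.induction_on generalizing g b with
  | empty =>
    rw [Finset.coe_empty, Set.image_empty, adjoin_empty, mem_bot] at hg
    obtain ⟨h, rfl⟩ := hg
    exact ⟨0, h, by simp, by simp, by simp⟩
  | insert j s hj ih =>
    have hderiv (c : ι → F) (h : F) (hc : ∀ i, (c i)′ = 0) :
        (∑ i, algebraMap F E (c i) * x i + algebraMap F E h)′ =
          algebraMap F E (∑ i, c i * f i + h′) := by
      simp [Derivation.leibniz, deriv_algebraMap, hc, hxf]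
    set K := adjoin F (x '' s) with hK
    have hKderiv (a : E) (ha : a ∈ K) : a′ ∈ K := by
      refine deriv_mem_adjoin ?_ ha
      rintro _ ⟨i, -, rfl⟩
      rw [hxf]
      exact IntermediateField.algebraMap_mem _ _
    let : Differential K := K.differentialOfDerivMem hKderiv
    have : DifferentialAlgebra K E := ⟨fun _ ↦ rfl⟩
    have : CharZero K := charZero_of_injective_algebraMap (algebraMap F K).injective
    have hcoe (a : K) : ((a′ : K) : E) = (a : E)′ := rfl
    have htr : Transcendental K (x j) := fun h ↦
      hx.transcendental_adjoin (s := s) (by simpa using hj)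
        (IntermediateField.isAlgebraic_adjoin_iff.mp h)
    have hfj (u : K) : u′ ≠ algebraMap F K (f j) := by
      intro hu
      have hu' : (u : E)′ = algebraMap F E (f j) := by rw [← hcoe, hu]; rfl
      obtain ⟨c, h, hc, hcs, huc⟩ := ih u.2 hu'
      rw [huc, hderiv c h hc] at hu'
      have hsum : ∑ i, c i * f i + h′ = f j := (algebraMap F E).injective hu'
      have := hf (c - Pi.single j 1) (-h)
        (fun i ↦ by by_cases hij : i = j <;> simp [hij, hc])
        (by simp [sub_mul, Finset.sum_sub_distrib, Pi.single_apply, ← hsum]) j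
      simp [hcs j hj] at this
    have hgK : g ∈ K⟮x j⟯ := by
      rw [← mem_restrictScalars (K := F), hK, adjoin_adjoin_left]
      rwa [Finset.coe_insert, Set.image_insert_eq, ← Set.union_singleton] at hg
    obtain ⟨a, h, ha, rfl⟩ := exists_eq_of_mem_adjoin_simple_of_deriv_eq hfj htr (hxf j) hgK
      (b := algebraMap F K b) hgb
    have ha' : (a : E)′ = algebraMap F E 0 := by rw [← hcoe, ha]; simp
    obtain ⟨c, a₀, hc, -, hac⟩ := ih a.2 ha'
    have hc0 : ∀ i, c i = 0 := by
      refine hf c (-a₀) hc ?_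
      rw [hac, hderiv c a₀ hc] at ha'
      rw [map_neg]
      exact eq_neg_of_add_eq_zero_left ((algebraMap F E).injective ha')
    have haa₀ : (a : E) = algebraMap F E a₀ := by simp [hac, hc0]
    have ha₀ : a₀′ = 0 := by
      rw [haa₀, deriv_algebraMap] at ha'
      exact (algebraMap F E).injective ha'
    have hh : (h : E)′ = algebraMap F E (b - a₀ * f j) := by
      have : (algebraMap F E a₀ * x j + (h : E))′ = algebraMap F E b := by
        rw [← haa₀]; exact hgb
      simp only [map_add, Derivation.leibniz, deriv_algebraMap, ha₀, hxf, smul_eq_mul, map_zero,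
        mul_zero, add_zero] at this
      rw [map_sub, map_mul, ← this]
      ring
    obtain ⟨d, h₀, hd, hds, hhd⟩ := ih h.2 hh
    refine ⟨d + Pi.single j a₀, h₀, fun i ↦ ?_, fun i hi ↦ ?_, ?_⟩
    · by_cases hij : i = j <;> simp [hij, hd, ha₀]
    · rw [Finset.mem_insert, not_or] at hi
      simp [hi.1, hds i hi.2]
    · change (a : E) * x j + (h : E) = _
      rw [haa₀, hhd]
      simp [add_mul, Finset.sum_add_distrib, Pi.single_apply, apply_ite (algebraMap F E)]
      ring

end Antiderivatives

/-- Let `F` be a differential field of characteristic zero with field of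
constants `C`, and let `f₁, …, fₙ ∈ F` satisfy condition (C).  If `E = F(x₁, …, xₙ)` with
the `xᵢ` algebraically independent over `F` and `xᵢ′ = fᵢ`, then every constant of `E`
lies in `C` (the constants of `F`); i.e. `E` is a no new constants extension of `F`. -/
theorem no_new_constants_of_antiderivatives
    (E : Type) [Field E] [CharZero E] (D : Derivation ℚ E E)
    (F : Subfield E) (hF : ∀ a ∈ F, D a ∈ F)
    (n : ℕ) (f : Fin n → E) (hf : ∀ i, f i ∈ F)
    (hcondC : ∀ (c : Fin n → E) (g : E), (∀ i, c i ∈ F ∧ D (c i) = 0) → g ∈ F →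
      (∑ i, c i * f i) = D g → ∀ i, c i = 0)
    (x : Fin n → E) (hind : AlgebraicIndependent F x)
    (hder : ∀ i, D (x i) = f i)
    (hgen : Subfield.closure (↑F ∪ Set.range x) = ⊤) :
    ∀ c : E, D c = 0 → c ∈ F := by
  intro c hc
  let : Differential E := ⟨D.restrictScalars ℤ⟩
  let : Differential F := ⟨Derivation.mk'
    { toFun := fun a ↦ ⟨D a, hF a a.2⟩
      map_add' := fun a b ↦ Subtype.ext (by simp)
      map_smul' := fun n a ↦ Subtype.ext (by simp) }
    fun a b ↦ Subtype.ext (by simp)⟩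
  have : DifferentialAlgebra F E := ⟨fun _ ↦ rfl⟩
  have hcoe (a : F) : ((a′ : F) : E) = D a := rfl
  have hC (c : Fin n → F) (g : F) (hc : ∀ i, (c i)′ = 0)
      (hg : ∑ i, c i * (⟨f i, hf i⟩ : F) = g′) (i : Fin n) : c i = 0 := by
    refine Subtype.ext (hcondC (fun i ↦ c i) g (fun i ↦ ⟨(c i).2, ?_⟩) g.2 ?_ i)
    · rw [← hcoe, hc]; rfl
    · rw [← hcoe, ← hg]; simp
  have hmem : c ∈ adjoin F (x '' (Finset.univ : Finset (Fin n))) := by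
    have hle : Subfield.closure (↑F ∪ Set.range x) ≤ (adjoin F (Set.range x)).toSubfield := by
      rw [Subfield.closure_le, Set.union_subset_iff]
      exact ⟨fun a ha ↦ (adjoin F (Set.range x)).algebraMap_mem ⟨a, ha⟩, subset_adjoin F _⟩
    rw [Finset.coe_univ, Set.image_univ]
    exact hle (hgen ▸ Subfield.mem_top c)
  obtain ⟨a, h, ha, -, rfl⟩ := exists_eq_sum_of_mem_adjoin_of_deriv_eq hC hind hder
    Finset.univ hmem (b := 0) hc
  have ha0 : ∀ i, a i = 0 := by
    refine hC a (-h) ha (Subtype.ext ?_)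
    have hD (i : Fin n) : D (a i : E) = 0 := by rw [← hcoe, ha]; rfl
    have hc' : D (∑ i, (a i : E) * x i + h) = 0 := hc
    simp only [map_add, map_sum, Derivation.leibniz, hD, hder, smul_eq_mul, mul_zero,
      add_zero] at hc'
    rw [hcoe]
    simpa using eq_neg_of_add_eq_zero_left hc'
  simp only [ha0, map_zero, zero_mul, Finset.sum_const_zero, zero_add]
  exact h.2
end

section
/- Let F = ℂ(z) be the field of rational functions in one variable over ℂ with the derivation d/dz, let α₁, …, αₙ be distinct complex numbers, and let c₁, …, cₙ ∈ ℂ. If there exists a rational function f ∈ ℂ(z) with f′ = Σᵢ cᵢ/(z + αᵢ), then cᵢ = 0 for all i. In particular, the elements 1/(z + α₁), …, 1/(z + αₙ) of ℂ(z) satisfy condition (C). -/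
open Polynomial

/-- A derivation of `K(z)` with `z′ = 1` that kills the constants restricts to the formal
derivative on polynomials. -/
lemma derivation_algebraMap_polynomial {K : Type*} [Field K] [Algebra ℚ (RatFunc K)]
    (D : Derivation ℚ (RatFunc K) (RatFunc K)) (hDX : D RatFunc.X = 1)
    (hDC : ∀ a : K, D (RatFunc.C a) = 0) (p : K[X]) :
    D (algebraMap K[X] (RatFunc K) p) = algebraMap K[X] (RatFunc K) (derivative p) := by
  induction p using Polynomial.induction_on' with
  | add p q hp hq => simp only [map_add, hp, hq]
  | monomial n a =>
    rw [← C_mul_X_pow_eq_monomial, derivative_C_mul_X_pow]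
    simp [hDX, hDC, Derivation.leibniz_pow]
    ring

/-- The derivative of a rational function `p / q` has no simple pole: if
`(p / q)′ = N / ((X - a) * P)` with `P` nonzero at `a`, then `N` vanishes at `a`. -/
lemma eval_eq_zero_of_wronskian_mul_eq {K : Type*} [Field K] [CharZero K]
    {p q N P : K[X]} {a : K} (hq : q ≠ 0) (hpq : IsCoprime p q) (hP : P.eval a ≠ 0)
    (h : (derivative p * q - p * derivative q) * ((X - C a) * P) = N * q ^ 2) :
    N.eval a = 0 := by
  obtain ⟨r, hqr, hr⟩ := exists_eq_pow_rootMultiplicity_mul_and_not_dvd q hq a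
  rw [dvd_iff_isRoot, IsRoot.def] at hr
  generalize q.rootMultiplicity a = m at hqr
  cases m with
  | zero =>
    have heval := congrArg (eval a) h
    simpa [hqr, hr] using heval
  | succ m =>
    exfalso
    have hpa : p.eval a ≠ 0 := by
      obtain ⟨u, v, huv⟩ := hpq
      intro h0
      have heval := congrArg (eval a) huv
      simp [hqr, h0] at heval
    have key : (derivative p * ((X - C a) * r)
        - p * ((m + 1 : K[X]) * r + (X - C a) * derivative r)) * P
        = N * (X - C a) ^ (m + 1) * r ^ 2 := by
      apply mul_left_cancel₀ (pow_ne_zero (m + 1) (X_sub_C_ne_zero a))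
      have hderiv : derivative q =
          (X - C a) ^ m * ((m + 1 : K[X]) * r + (X - C a) * derivative r) := by
        rw [hqr, derivative_mul, derivative_X_sub_C_pow]
        simp
        ring
      rw [hderiv, hqr] at h
      linear_combination h
    have heval := congrArg (eval a) key
    have hm : (m + 1 : K) ≠ 0 := by exact_mod_cast m.succ_ne_zero
    simp [hr, hpa, hP, hm] at heval

/-- In `F = ℂ(z)` with the derivation `d/dz` (characterized as the unique
derivation with `z′ = 1` that kills the complex constants), if `α₁, …, αₙ` are distinct
complex numbers, `c₁, …, cₙ ∈ ℂ`, and `f ∈ ℂ(z)` satisfies `f′ = Σᵢ cᵢ/(z + αᵢ)`, then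
`cᵢ = 0` for all `i`.  In particular the `1/(z + αᵢ)` satisfy condition (C). -/
theorem simple_poles_not_derivatives
    (D : Derivation ℚ (RatFunc ℂ) (RatFunc ℂ))
    (hDX : D RatFunc.X = 1)
    (hDC : ∀ a : ℂ, D (RatFunc.C a) = 0)
    (n : ℕ) (α : Fin n → ℂ) (hα : Function.Injective α)
    (c : Fin n → ℂ) (f : RatFunc ℂ)
    (hf : D f = ∑ i, RatFunc.C (c i) / (RatFunc.X + RatFunc.C (α i))) :
    ∀ i, c i = 0 := by
  intro i
  have hlin (j : Fin n) : RatFunc.X + RatFunc.C (α j)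
      = algebraMap ℂ[X] (RatFunc ℂ) (X + C (α j)) := by simp
  have hlin0 (j : Fin n) : algebraMap ℂ[X] (RatFunc ℂ) (X + C (α j)) ≠ 0 :=
    RatFunc.algebraMap_ne_zero (X_add_C_ne_zero _)
  have hq0 := RatFunc.algebraMap_ne_zero f.denom_ne_zero
  set N : ℂ[X] := ∑ j, C (c j) * ∏ k ∈ Finset.univ.erase j, (X + C (α k)) with hN
  set P : ℂ[X] := ∏ k ∈ Finset.univ.erase i, (X + C (α k)) with hP
  have hPi : P.eval (-α i) ≠ 0 := by
    rw [hP, eval_prod, Finset.prod_ne_zero_iff]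
    intro k hk h0
    apply Finset.ne_of_mem_erase hk
    apply hα
    simp only [eval_add, eval_X, eval_C] at h0
    linear_combination h0
  have hNi : N.eval (-α i) = c i * P.eval (-α i) := by
    rw [hN, eval_finsetSum, Finset.sum_eq_single i]
    · simp [hP]
    · intro j _ hji
      rw [eval_mul, eval_prod,
        Finset.prod_eq_zero (Finset.mem_erase.2 ⟨hji.symm, Finset.mem_univ i⟩), mul_zero]
      simp
    · simp
  have hsum : D f * algebraMap ℂ[X] (RatFunc ℂ) ((X + C (α i)) * P)
      = algebraMap ℂ[X] (RatFunc ℂ) N := by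
    rw [hf, hP, Finset.mul_prod_erase _ (fun k => X + C (α k)) (Finset.mem_univ i), hN, map_sum,
      Finset.sum_mul]
    refine Finset.sum_congr rfl fun j _ => ?_
    rw [hlin, ← Finset.mul_prod_erase _ (fun k => X + C (α k)) (Finset.mem_univ j), map_mul,
      map_mul, RatFunc.algebraMap_C, ← mul_assoc, div_mul_cancel₀ _ (hlin0 j)]
  have hDf : D f * algebraMap ℂ[X] (RatFunc ℂ) f.denom ^ 2
      = algebraMap ℂ[X] (RatFunc ℂ) (derivative f.num * f.denom - f.num * derivative f.denom) := by
    conv_lhs => rw [← RatFunc.num_div_denom f, Derivation.leibniz_div]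
    simp only [RatFunc.num_div_denom, derivation_algebraMap_polynomial D hDX hDC, smul_eq_mul,
      map_sub, map_mul]
    field_simp
  have hmain : (derivative f.num * f.denom - f.num * derivative f.denom)
      * ((X - C (-α i)) * P) = N * f.denom ^ 2 := by
    apply RatFunc.algebraMap_injective ℂ
    rw [C_neg, sub_neg_eq_add, map_mul, ← hDf, map_mul _ N, ← hsum, map_pow]
    ring
  have h0 := eval_eq_zero_of_wronskian_mul_eq f.denom_ne_zero f.isCoprime_num_denom hPi hmain
  rw [hNi] at h0
  exact (mul_eq_zero.1 h0).resolve_right hPi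
end

section
/- Let F be a field of characteristic zero and let E = F(x_{i,j} : 1 ≤ i ≤ n, 1 ≤ j ≤ n+1−i) be a field extension of F generated by n(n+1)/2 elements x_{i,j} that are algebraically independent over F. For each upper unitriangular matrix M ∈ U(n+1, F) with entries c_{i,j} (so M has (1, c_{1,1}, c_{2,1}, …, c_{n,1}) in the first row, etc.), let σ_M be the F-algebra automorphism of E determined by σ_M(x_{1,j}) = x_{1,j} + c_{1,j} and, for i ≥ 2, σ_M(x_{i,j}) = x_{i,j} + Σ_{t=1}^{i−1} c_{t, i+j−t}·x_{i−t, j} + c_{i,j}. Then the fixed field of the group G = {σ_M : M ∈ U(n+1,F)} equals F; that is, if u ∈ E satisfies σ_M(u) = u for every M ∈ U(n+1,F), then u ∈ F. -/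
open MvPolynomial

/-- The entry `(i, j)` of the translate of `y` by the unipotent matrix with entries `c`. -/
def unipotentTranslate {F A : Type*} [CommRing F] [CommRing A] [Algebra F A]
    (c : ℕ → ℕ → F) (y : ℕ → ℕ → A) (i j : ℕ) : A :=
  y i j + (∑ t ∈ Finset.Icc 1 (i - 1), c t (i + j - t) • y (i - t) j) + algebraMap F A (c i j)

/-- The solution `r` of the triangular system `unipotentTranslate c r = y`. -/
def unipotentSolve {F A : Type*} [CommRing F] [CommRing A] [Algebra F A]
    (c : ℕ → ℕ → F) (y : ℕ → ℕ → A) (i j : ℕ) : A :=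
  y i j - (∑ t : Finset.Icc 1 (i - 1), c t (i + j - t) • unipotentSolve c y (i - t) j)
    - algebraMap F A (c i j)
termination_by i
decreasing_by
  have := Finset.mem_Icc.1 t.2
  omega

/-- The matrix entries `c` carrying `y` to `z`. -/
def unipotentTransporter {F : Type*} [CommRing F] (y z : ℕ → ℕ → F) (i j : ℕ) : F :=
  z i j - y i j - ∑ t : Finset.Icc 1 (i - 1),
    unipotentTransporter y z t (i + j - t) * y (i - t) j
termination_by i
decreasing_by
  have := Finset.mem_Icc.1 t.2
  omega

section Translate

variable {F A B : Type*} [CommRing F] [CommRing A] [Algebra F A] [CommRing B] [Algebra F B]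

theorem unipotentSolve_eq (c : ℕ → ℕ → F) (y : ℕ → ℕ → A) (i j : ℕ) :
    unipotentSolve c y i j =
      y i j - (∑ t ∈ Finset.Icc 1 (i - 1), c t (i + j - t) • unipotentSolve c y (i - t) j)
        - algebraMap F A (c i j) := by
  rw [unipotentSolve, ← Finset.sum_coe_sort (Finset.Icc 1 (i - 1))]

theorem unipotentTranslate_solve (c : ℕ → ℕ → F) (y : ℕ → ℕ → A) (i j : ℕ) :
    unipotentTranslate c (unipotentSolve c y) i j = y i j := by
  rw [unipotentTranslate, unipotentSolve_eq]
  ring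

theorem unipotentTranslate_transporter (y z : ℕ → ℕ → F) (i j : ℕ) :
    unipotentTranslate (unipotentTransporter y z) y i j = z i j := by
  rw [unipotentTranslate, Algebra.algebraMap_self_apply, unipotentTransporter,
    ← Finset.sum_coe_sort (Finset.Icc 1 (i - 1))]
  simp only [smul_eq_mul]
  ring

theorem map_unipotentTranslate (f : A →ₐ[F] B) (c : ℕ → ℕ → F) (y : ℕ → ℕ → A) (i j : ℕ) :
    f (unipotentTranslate c y i j) = unipotentTranslate c (fun i j => f (y i j)) i j := by
  simp [unipotentTranslate]

theorem unipotentTranslate_congr {n : ℕ} {c : ℕ → ℕ → F} {y z : ℕ → ℕ → A}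
    (h : ∀ i j, 1 ≤ i → 1 ≤ j → i + j ≤ n + 1 → y i j = z i j)
    {i j : ℕ} (hi : 1 ≤ i) (hj : 1 ≤ j) (hij : i + j ≤ n + 1) :
    unipotentTranslate c y i j = unipotentTranslate c z i j := by
  rw [unipotentTranslate, unipotentTranslate, h i j hi hj hij]
  congr 2
  refine Finset.sum_congr rfl fun t ht => ?_
  have := Finset.mem_Icc.1 ht
  rw [h (i - t) j (by omega) hj (by omega)]

end Translate

/-- Positions strictly above the diagonal of an `(n + 1) × (n + 1)` matrix: `(i, j)` stands for
the `j`-th entry of the `i`-th superdiagonal. -/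
abbrev SuperdiagonalIndex (n : ℕ) : Type :=
  {p : ℕ × ℕ // 1 ≤ p.1 ∧ 1 ≤ p.2 ∧ p.1 + p.2 ≤ n + 1}

section Polynomial

variable {F A : Type*} [CommRing F] [CommRing A] [Algebra F A] {n : ℕ}

/-- A family on superdiagonal positions, extended by zero to all of `ℕ × ℕ`. -/
def extendByZero (v : SuperdiagonalIndex n → A) (i j : ℕ) : A :=
  if h : 1 ≤ i ∧ 1 ≤ j ∧ i + j ≤ n + 1 then v ⟨(i, j), h⟩ else 0

theorem extendByZero_of_mem (v : SuperdiagonalIndex n → A) {i j : ℕ}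
    (h : 1 ≤ i ∧ 1 ≤ j ∧ i + j ≤ n + 1) : extendByZero v i j = v ⟨(i, j), h⟩ :=
  dif_pos h

theorem extendByZero_coe (v : SuperdiagonalIndex n → A) (p : SuperdiagonalIndex n) :
    extendByZero v p.1.1 p.1.2 = v p :=
  extendByZero_of_mem v p.2

theorem map_extendByZero_X (f : MvPolynomial (SuperdiagonalIndex n) F →ₐ[F] A) (i j : ℕ) :
    f (extendByZero X i j) = extendByZero (fun p => f (X p)) i j := by
  unfold extendByZero
  split_ifs <;> simp

/-- The polynomial endomorphism translating the generic unipotent matrix. -/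
noncomputable def translateHom (n : ℕ) (c : ℕ → ℕ → F) :
    MvPolynomial (SuperdiagonalIndex n) F →ₐ[F] MvPolynomial (SuperdiagonalIndex n) F :=
  aeval fun p => unipotentTranslate c (extendByZero X) p.1.1 p.1.2

/-- The inverse of `translateHom`. -/
noncomputable def translateInvHom (n : ℕ) (c : ℕ → ℕ → F) :
    MvPolynomial (SuperdiagonalIndex n) F →ₐ[F] MvPolynomial (SuperdiagonalIndex n) F :=
  aeval fun p => unipotentSolve c (extendByZero X) p.1.1 p.1.2

theorem translateInvHom_comp_translateHom (c : ℕ → ℕ → F) :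
    (translateInvHom n c).comp (translateHom n c) = AlgHom.id F _ := by
  ext1 p
  obtain ⟨⟨i, j⟩, hi, hj, hij⟩ := p
  rw [AlgHom.comp_apply, translateHom, aeval_X, map_unipotentTranslate,
    unipotentTranslate_congr (z := unipotentSolve c (extendByZero X)) _ hi hj hij,
    unipotentTranslate_solve, extendByZero_of_mem _ ⟨hi, hj, hij⟩, AlgHom.id_apply]
  intro i j hi hj hij
  rw [extendByZero_of_mem _ ⟨hi, hj, hij⟩, translateInvHom, aeval_X]

theorem translateHom_unipotentSolve (c : ℕ → ℕ → F) (i j : ℕ) (hi : 1 ≤ i) (hj : 1 ≤ j)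
    (hij : i + j ≤ n + 1) :
    translateHom n c (unipotentSolve c (extendByZero X) i j) = extendByZero X i j := by
  induction i using Nat.strong_induction_on with
  | _ i ih =>
    have hsum : ∑ t ∈ Finset.Icc 1 (i - 1), c t (i + j - t) •
          translateHom n c (unipotentSolve c (extendByZero X) (i - t) j) =
        ∑ t ∈ Finset.Icc 1 (i - 1), c t (i + j - t) •
          (extendByZero X (i - t) j : MvPolynomial (SuperdiagonalIndex n) F) := by
      refine Finset.sum_congr rfl fun t ht => ?_
      have := Finset.mem_Icc.1 ht
      rw [ih (i - t) (by omega) (by omega) (by omega)]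
    have hX : translateHom n c (extendByZero X i j) =
        unipotentTranslate c (extendByZero X) i j := by
      rw [extendByZero_of_mem _ ⟨hi, hj, hij⟩, translateHom, aeval_X]
    rw [unipotentSolve_eq, map_sub, map_sub, map_sum, AlgHom.commutes, hX]
    simp only [map_smul]
    rw [hsum, unipotentTranslate]
    ring

theorem translateHom_comp_translateInvHom (c : ℕ → ℕ → F) :
    (translateHom n c).comp (translateInvHom n c) = AlgHom.id F _ := by
  ext1 p
  rw [AlgHom.comp_apply, translateInvHom, aeval_X,
    translateHom_unipotentSolve c _ _ p.2.1 p.2.2.1 p.2.2.2, extendByZero_coe, AlgHom.id_apply]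

/-- Translation of the generic unipotent matrix, as a polynomial automorphism. -/
noncomputable def translateEquiv (n : ℕ) (c : ℕ → ℕ → F) :
    MvPolynomial (SuperdiagonalIndex n) F ≃ₐ[F] MvPolynomial (SuperdiagonalIndex n) F :=
  AlgEquiv.ofAlgHom (translateHom n c) (translateInvHom n c)
    (translateHom_comp_translateInvHom c) (translateInvHom_comp_translateHom c)

theorem aeval_translateEquiv_X (c : ℕ → ℕ → F) (v : SuperdiagonalIndex n → A)
    (p : SuperdiagonalIndex n) :
    aeval v (translateEquiv n c (X p)) =
      unipotentTranslate c (extendByZero v) p.1.1 p.1.2 := by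
  change aeval v (translateHom n c (X p)) = _
  rw [translateHom, aeval_X, map_unipotentTranslate]
  simp only [map_extendByZero_X, aeval_X]

theorem aeval_translateEquiv_transporter (v w : SuperdiagonalIndex n → F)
    (p : MvPolynomial (SuperdiagonalIndex n) F) :
    aeval v (translateEquiv n (unipotentTransporter (extendByZero v) (extendByZero w)) p) =
      aeval w p := by
  have h : (aeval v).comp (translateEquiv n
      (unipotentTransporter (extendByZero v) (extendByZero w))).toAlgHom = aeval w := by
    ext1 p
    refine (aeval_translateEquiv_X _ v p).trans ?_
    rw [unipotentTranslate_transporter, extendByZero_coe, aeval_X]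
  exact DFunLike.congr_fun h p

end Polynomial

/-- An automorphism of a polynomial ring extends to the field generated by algebraically
independent elements. -/
theorem AlgebraicIndependent.exists_algEquiv_extending {ι F E : Type*} [Field F] [Field E]
    [Algebra F E] {v : ι → E} (hv : AlgebraicIndependent F v)
    (hgen : ∀ z : E, ∃ p q : MvPolynomial ι F, z = aeval v p / aeval v q)
    (τ : MvPolynomial ι F ≃ₐ[F] MvPolynomial ι F) :
    ∃ σ : E ≃ₐ[F] E, ∀ p, σ (aeval v p) = aeval v (τ p) := by
  let _ : Algebra (MvPolynomial ι F) E := (aeval v).toRingHom.toAlgebra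
  have : IsScalarTower F (MvPolynomial ι F) E :=
    IsScalarTower.of_algebraMap_eq fun r => ((aeval v).commutes r).symm
  have : FaithfulSMul (MvPolynomial ι F) E := (faithfulSMul_iff_algebraMap_injective _ _).2 hv
  have : IsFractionRing (MvPolynomial ι F) E := IsFractionRing.of_field _ _ hgen
  exact ⟨IsFractionRing.fieldEquivOfAlgEquiv F E E τ,
    fun p => IsFractionRing.fieldEquivOfAlgEquiv_algebraMap F E E τ p⟩

/-- If `p / q` is invariant under a family of polynomial automorphisms that acts transitively on
points, then it is constant. -/
theorem aeval_div_aeval_mem_range_algebraMap {ι F E : Type*} [Field F] [Infinite F] [Field E]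
    [Algebra F E] {v : ι → E} (hv : AlgebraicIndependent F v)
    {T : Type*} (τ : T → MvPolynomial ι F ≃ₐ[F] MvPolynomial ι F)
    (htrans : ∀ y z : ι → F, ∃ t, ∀ p, aeval y (τ t p) = aeval z p)
    {p q : MvPolynomial ι F} (hq : q ≠ 0)
    (hinv : ∀ t, aeval v (τ t p) / aeval v (τ t q) = aeval v p / aeval v q) :
    aeval v p / aeval v q ∈ Set.range (algebraMap F E) := by
  have hne : ∀ r : MvPolynomial ι F, r ≠ 0 → aeval v r ≠ 0 := fun r hr h =>
    hr (hv (h.trans (map_zero _).symm))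
  have hmul : ∀ t, τ t p * q = p * τ t q := fun t => hv <| by
    have h := hinv t
    rw [div_eq_div_iff (hne _ ((map_ne_zero_iff _ (τ t).injective).2 hq)) (hne _ hq)] at h
    rw [map_mul, map_mul, h]
  obtain ⟨y, hy⟩ : ∃ y : ι → F, aeval y q ≠ 0 := by
    by_contra! h
    exact hq (MvPolynomial.funext fun y => by simpa [aeval_eq_eval] using h y)
  have hprop : p * C (aeval y q) = C (aeval y p) * q := MvPolynomial.funext fun z => by
    obtain ⟨t, ht⟩ := htrans y z
    have h := congrArg (aeval y) (hmul t)
    rw [map_mul, map_mul, ht, ht] at h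
    simpa [aeval_eq_eval] using h
  refine ⟨aeval y p / aeval y q, ?_⟩
  have h := congrArg (aeval v) hprop
  simp only [map_mul, aeval_C] at h
  rw [map_div₀, div_eq_div_iff ((map_ne_zero _).2 hy) (hne _ hq), ← h]

theorem exists_eq_aeval_div_aeval_of_closure_eq_top {E ι : Type*} [Field E] (F : Subfield E)
    (v : ι → E) (hgen : Subfield.closure (↑F ∪ Set.range v) = ⊤) (z : E) :
    ∃ p q : MvPolynomial ι F, z = aeval v p / aeval v q := by
  rw [← IntermediateField.mem_adjoin_range_iff]
  have hz : z ∈ Subfield.closure (↑F ∪ Set.range v) := hgen ▸ Subfield.mem_top z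
  refine (Subfield.closure_le (t := (IntermediateField.adjoin F (Set.range v)).toSubfield)).2
    ?_ hz
  rintro a (ha | ha)
  · exact (IntermediateField.adjoin F (Set.range v)).algebraMap_mem ⟨a, ha⟩
  · exact IntermediateField.subset_adjoin F _ ha

/-- Let `E = F(x_{i,j} : 1 ≤ i ≤ n, 1 ≤ j ≤ n+1−i)` be a purely
transcendental extension of a field `F` of characteristic zero.  For each upper
unitriangular matrix with entries `c_{i,j}` in `F`, the automorphism `σ_M` acts by
`σ_M(x_{i,j}) = x_{i,j} + Σ_{t=1}^{i−1} c_{t,i+j−t}·x_{i−t,j} + c_{i,j}`.  The fixed field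
of the group of all such `σ_M` is exactly `F`: any `u ∈ E` fixed by all of them lies
in `F`. -/
theorem fixed_field_of_unipotent_translations
    (E : Type) [Field E] [CharZero E] (F : Subfield E) (n : ℕ)
    (x : ℕ → ℕ → E)
    (hind : AlgebraicIndependent F
      (fun p : {p : ℕ × ℕ // 1 ≤ p.1 ∧ 1 ≤ p.2 ∧ p.1 + p.2 ≤ n + 1} => x p.1.1 p.1.2))
    (hgen : Subfield.closure
      (↑F ∪ {a | ∃ i j, 1 ≤ i ∧ 1 ≤ j ∧ i + j ≤ n + 1 ∧ a = x i j}) = ⊤)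
    (u : E)
    (hu : ∀ (σ : E ≃+* E) (c : ℕ → ℕ → E),
      (∀ a ∈ F, σ a = a) →
      (∀ i j, 1 ≤ i → 1 ≤ j → i + j ≤ n + 1 → c i j ∈ F) →
      (∀ i j, 1 ≤ i → 1 ≤ j → i + j ≤ n + 1 →
        σ (x i j) = x i j + (∑ t ∈ Finset.Icc 1 (i - 1), c t (i + j - t) * x (i - t) j)
          + c i j) →
      σ u = u) :
    u ∈ F := by
  set v : SuperdiagonalIndex n → E := fun p => x p.1.1 p.1.2
  have hset : {a | ∃ i j, 1 ≤ i ∧ 1 ≤ j ∧ i + j ≤ n + 1 ∧ a = x i j} = Set.range v := by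
    ext a
    constructor
    · rintro ⟨i, j, hi, hj, hij, rfl⟩
      exact ⟨⟨(i, j), hi, hj, hij⟩, rfl⟩
    · rintro ⟨⟨⟨i, j⟩, hi, hj, hij⟩, rfl⟩
      exact ⟨i, j, hi, hj, hij, rfl⟩
  have hfrac := exists_eq_aeval_div_aeval_of_closure_eq_top F v (hset ▸ hgen)
  have hext : ∀ i j, 1 ≤ i → 1 ≤ j → i + j ≤ n + 1 → extendByZero v i j = x i j :=
    fun i j hi hj hij => extendByZero_of_mem v ⟨hi, hj, hij⟩
  obtain ⟨p, q, rfl⟩ := hfrac u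
  rcases eq_or_ne q 0 with rfl | hq
  · simp [F.zero_mem]
  obtain ⟨a, ha⟩ := aeval_div_aeval_mem_range_algebraMap hind (p := p) (translateEquiv n)
    (fun y z => ⟨_, aeval_translateEquiv_transporter y z⟩) hq fun c => by
      obtain ⟨σ, hσ⟩ := hind.exists_algEquiv_extending hfrac (translateEquiv n c)
      rw [← hσ, ← hσ, ← map_div₀]
      refine hu σ.toRingEquiv (fun i j => c i j) (fun a ha => σ.commutes ⟨a, ha⟩)
        (fun i j _ _ _ => (c i j).2) fun i j hi hj hij => ?_
      have h := hσ (X ⟨(i, j), hi, hj, hij⟩)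
      rw [aeval_X, aeval_translateEquiv_X, unipotentTranslate_congr hext hi hj hij] at h
      exact h
  rw [← ha]
  exact a.2
end

section
/- Let F be a differential field of characteristic zero with field of constants C, let f₁, f₂ ∈ F satisfy condition (C), let r ∈ F, and let F ⊆ E be an extension of differential fields with E = F(x₁, x₂, y), where x₁, x₂, y are algebraically independent over F and x₁′ = f₁, x₂′ = f₂, y′ = f₁·x₂ + r. Then: (1) for every differential automorphism σ of E fixing F pointwise there exist unique constants α, β, ρ ∈ C such that σ(x₁) = x₁ + α, σ(x₂) = x₂ + β, and σ(y) = y + β·x₁ + ρ; (2) conversely, for every (α, β, ρ) ∈ C³ there is a unique differential automorphism σ of E fixing F pointwise with σ(x₁) = x₁ + α, σ(x₂) = x₂ + β, σ(y) = y + β·x₁ + ρ. Consequently the group of differential automorphisms of E over F is isomorphic to the Heisenberg group U(3, C). -/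
/-- The group of differential automorphisms of `E` fixing the subfield `F` pointwise. -/
def diffGal (E : Type) [Field E] [CharZero E] (D : Derivation ℚ E E) (F : Subfield E) :
    Subgroup (RingAut E) where
  carrier := {σ | (∀ a ∈ F, σ a = a) ∧ ∀ a, σ (D a) = D (σ a)}
  one_mem' := ⟨fun _ _ => rfl, fun _ => rfl⟩
  mul_mem' := by
    rintro σ τ ⟨hσF, hσD⟩ ⟨hτF, hτD⟩
    refine ⟨fun a ha => ?_, fun a => ?_⟩
    · show σ (τ a) = a
      rw [hτF a ha, hσF a ha]
    · show σ (τ (D a)) = D (σ (τ a))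
      rw [hτD a, hσD (τ a)]
  inv_mem' := by
    rintro σ ⟨hσF, hσD⟩
    have hinv : ∀ a, (σ⁻¹ : RingAut E) a = σ.symm a := fun _ => rfl
    refine ⟨fun a ha => ?_, fun a => ?_⟩
    · rw [hinv]
      exact σ.injective (by rw [σ.apply_symm_apply, hσF a ha])
    · rw [hinv, hinv]
      apply σ.injective
      rw [σ.apply_symm_apply, hσD (σ.symm a), σ.apply_symm_apply]

open Polynomial IntermediateField

section PrimitiveExtension

variable {K E : Type*} [Field K] [Field E] [CharZero E] [Algebra K E]
  {D : Derivation ℚ E E}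

/-- If `K` is stable under `D` and `D t` lies in `K`, then `D` maps polynomials in `t` over `K`
to polynomials in `t` over `K`. -/
theorem exists_aeval_eq_derivation_aeval
    (hK : ∀ a : K, ∃ b : K, D (algebraMap K E a) = algebraMap K E b) {t : E} {a : K}
    (ht : D t = algebraMap K E a) (p : K[X]) :
    ∃ q : K[X], D (aeval t p) = aeval t q ∧ ∀ n, algebraMap K E (q.coeff n) =
      D (algebraMap K E (p.coeff n)) + (n + 1) * algebraMap K E (p.coeff (n + 1)) * D t := by
  induction p using Polynomial.induction_on' with
  | add p₁ p₂ ih₁ ih₂ =>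
    obtain ⟨q₁, h₁, h₁'⟩ := ih₁
    obtain ⟨q₂, h₂, h₂'⟩ := ih₂
    refine ⟨q₁ + q₂, by simp [h₁, h₂], fun n => ?_⟩
    simp only [coeff_add, map_add, h₁', h₂']
    ring
  | monomial m c =>
    obtain ⟨b, hb⟩ := hK c
    refine ⟨monomial m b + C a * derivative (monomial m c), ?_, fun n => ?_⟩
    · simp only [aeval_monomial, map_add, map_mul, aeval_C, Derivation.leibniz,
        Derivation.leibniz_pow, derivative_monomial, hb, ht, smul_eq_mul, nsmul_eq_mul, map_natCast]
      ring
    · simp only [coeff_add, coeff_C_mul, coeff_derivative, coeff_monomial, map_add, map_mul, ht]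
      split_ifs <;> simp [hb] <;> ring

/-- The degree bound for a polynomial in a primitive `t` whose derivative has degree `< m`. -/
theorem natDegree_le_of_derivation_coeff_eq_zero {t : E}
    (ha : ∀ b : K, D (algebraMap K E b) ≠ D t) {m : ℕ} {p : K[X]}
    (hp : ∀ n, m ≤ n → D (algebraMap K E (p.coeff n)) +
      (n + 1) * algebraMap K E (p.coeff (n + 1)) * D t = 0) :
    p.natDegree ≤ m := by
  by_contra! hlt
  obtain ⟨k, hk⟩ : ∃ k, p.natDegree = k + 1 := ⟨p.natDegree - 1, by lia⟩
  have hlead : p.coeff (k + 1) ≠ 0 := by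
    rw [← hk, coeff_natDegree, Ne, leadingCoeff_eq_zero]
    rintro rfl
    simp at hk
  have hconst := hp (k + 1) (by lia)
  rw [coeff_eq_zero_of_natDegree_lt (show p.natDegree < k + 1 + 1 by lia)] at hconst
  have hnext := hp k (by lia)
  set c := p.coeff (k + 1)
  have hc : algebraMap K E c ≠ 0 := by simpa using hlead
  have hDc : D (algebraMap K E c) = 0 := by simpa using hconst
  have hk1 : ((k : E) + 1) ≠ 0 := Nat.cast_add_one_ne_zero k
  apply ha (-(p.coeff k) / ((k + 1 : ℕ) * c))
  have hden : D (algebraMap K E (((k + 1 : ℕ) : K) * c)) = 0 := by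
    simp [Derivation.leibniz, hDc]
  rw [map_div₀, Derivation.leibniz_div_const _ _ _ hden]
  simp only [map_neg, map_mul, map_natCast, smul_eq_mul]
  push_cast
  field_simp
  linear_combination -hnext

/-- An element of `K(t)` whose derivative is a polynomial in the primitive `t`
is itself a polynomial in `t`. -/
theorem exists_eq_aeval_of_derivation_eq_aeval
    (hK : ∀ a : K, ∃ b : K, D (algebraMap K E a) = algebraMap K E b) {t : E} {a : K}
    (ht : D t = algebraMap K E a) (htr : Transcendental K t)
    (ha : ∀ b : K, D (algebraMap K E b) ≠ D t) {g : E} (hg : g ∈ K⟮t⟯) {s : K[X]}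
    (hs : D g = aeval t s) : ∃ p : K[X], g = aeval t p := by
  have monic_case : ∀ n : ℕ, ∀ Q P : K[X], Q.Monic → Q.natDegree = n →
      g * aeval t Q = aeval t P → ∃ p : K[X], g = aeval t p := by
    intro n
    induction n using Nat.strong_induction_on with
    | _ n ih =>
      intro Q P hQ hn hgQ
      obtain ⟨Q', hQ', hcoeff⟩ := exists_aeval_eq_derivation_aeval hK ht Q
      obtain ⟨P', hP', -⟩ := exists_aeval_eq_derivation_aeval hK ht P
      have hvanish : ∀ k, n ≤ k → algebraMap K E (Q'.coeff k) = 0 := by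
        intro k hk
        rw [hcoeff, coeff_eq_zero_of_natDegree_lt (show Q.natDegree < k + 1 by lia)]
        rcases hk.eq_or_lt with rfl | hk
        · rw [← hn, hQ.coeff_natDegree]
          simp
        · rw [coeff_eq_zero_of_natDegree_lt (show Q.natDegree < k by lia)]
          simp
      by_cases hzero : Q' = 0
      · have hdeg : Q.natDegree ≤ 0 :=
          natDegree_le_of_derivation_coeff_eq_zero ha fun k _ => by
            rw [← hcoeff, hzero, coeff_zero, map_zero]
        rw [hQ.natDegree_eq_zero.mp (Nat.le_zero.mp hdeg), map_one, mul_one] at hgQ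
        exact ⟨P, hgQ⟩
      · have hlt : Q'.natDegree < n := by
          by_contra! hle
          have := hvanish _ hle
          simp [hzero] at this
        have hlc : Q'.leadingCoeff ≠ 0 := leadingCoeff_ne_zero.mpr hzero
        refine ih _ hlt (Q' * C Q'.leadingCoeff⁻¹) ((P' - s * Q) * C Q'.leadingCoeff⁻¹)
          (monic_mul_leadingCoeff_inv hzero) (natDegree_mul_leadingCoeff_inv _ hzero) ?_
        have hder := congrArg D hgQ
        rw [Derivation.leibniz, hQ', hP', hs, smul_eq_mul, smul_eq_mul] at hder
        simp only [map_mul, map_sub]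
        linear_combination (aeval t (C Q'.leadingCoeff⁻¹)) * hder
  obtain ⟨P, Q, rfl⟩ := (mem_adjoin_simple_iff K g).mp hg
  rcases eq_or_ne Q 0 with rfl | hQ
  · exact ⟨0, by simp⟩
  have hQt : aeval t Q ≠ 0 := fun h => hQ ((transcendental_iff.mp htr) Q h)
  refine monic_case _ (Q * C Q.leadingCoeff⁻¹) (P * C Q.leadingCoeff⁻¹)
    (monic_mul_leadingCoeff_inv hQ) rfl ?_
  simp only [map_mul]
  field_simp

/-- An element of `K(t)` whose derivative is a polynomial of degree `< m` in the primitive `t`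
is a polynomial of degree `≤ m` in `t`, and the coefficients determine each other. -/
theorem exists_polynomial_of_derivation_eq_aeval
    (hK : ∀ a : K, ∃ b : K, D (algebraMap K E a) = algebraMap K E b) {t : E} {a : K}
    (ht : D t = algebraMap K E a) (htr : Transcendental K t)
    (ha : ∀ b : K, D (algebraMap K E b) ≠ D t) {g : E} (hg : g ∈ K⟮t⟯) {s : K[X]}
    (hs : D g = aeval t s) {m : ℕ} (hm : ∀ n, m ≤ n → s.coeff n = 0) :
    ∃ p : K[X], g = aeval t p ∧ p.natDegree ≤ m ∧ ∀ n, algebraMap K E (s.coeff n) =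
      D (algebraMap K E (p.coeff n)) + (n + 1) * algebraMap K E (p.coeff (n + 1)) * D t := by
  obtain ⟨p, rfl⟩ := exists_eq_aeval_of_derivation_eq_aeval hK ht htr ha hg hs
  obtain ⟨q, hq, hcoeff⟩ := exists_aeval_eq_derivation_aeval hK ht p
  obtain rfl : s = q := transcendental_iff_injective.mp htr (hs.symm.trans hq)
  refine ⟨p, rfl, natDegree_le_of_derivation_coeff_eq_zero ha fun n hn => ?_, hcoeff⟩
  rw [← hcoeff, hm n hn, map_zero]

/-- Adjoining a transcendental primitive of a non-derivative creates no new constants. -/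
theorem exists_eq_algebraMap_of_derivation_eq_zero
    (hK : ∀ a : K, ∃ b : K, D (algebraMap K E a) = algebraMap K E b) {t : E} {a : K}
    (ht : D t = algebraMap K E a) (htr : Transcendental K t)
    (ha : ∀ b : K, D (algebraMap K E b) ≠ D t) {g : E} (hg : g ∈ K⟮t⟯) (hs : D g = 0) :
    ∃ b : K, g = algebraMap K E b := by
  obtain ⟨p, rfl, hp, -⟩ := exists_polynomial_of_derivation_eq_aeval hK ht htr ha hg
    (s := 0) (m := 0) (by simpa using hs) (by simp)
  exact ⟨p.coeff 0, by rw [eq_C_of_natDegree_le_zero hp]; simp⟩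

/-- An element of `K(t)` with derivative in `K` is `c * t + b` with `c` a constant. -/
theorem exists_eq_mul_add_of_derivation_eq_algebraMap
    (hK : ∀ a : K, ∃ b : K, D (algebraMap K E a) = algebraMap K E b) {t : E} {a : K}
    (ht : D t = algebraMap K E a) (htr : Transcendental K t)
    (ha : ∀ b : K, D (algebraMap K E b) ≠ D t) {g : E} (hg : g ∈ K⟮t⟯) {s : K}
    (hs : D g = algebraMap K E s) :
    ∃ c b : K, D (algebraMap K E c) = 0 ∧ g = algebraMap K E c * t + algebraMap K E b := by
  obtain ⟨p, rfl, hp, hcoeff⟩ := exists_polynomial_of_derivation_eq_aeval hK ht htr ha hg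
    (s := C s) (m := 1) (by simpa using hs) (fun n hn => coeff_C_of_ne_zero (by lia))
  refine ⟨p.coeff 1, p.coeff 0, ?_, ?_⟩
  · have h := hcoeff 1
    rw [coeff_eq_zero_of_natDegree_lt (show p.natDegree < 1 + 1 by lia),
      coeff_C_of_ne_zero one_ne_zero] at h
    simpa using h.symm
  · conv_lhs => rw [eq_X_add_C_of_natDegree_le_one hp]
    simp

/-- The intermediate field `K(t)` is stable under `D` if `D` maps `K` and `t` into it. -/
theorem derivation_mem_adjoin {S : Set E}
    (hK : ∀ a : K, D (algebraMap K E a) ∈ adjoin K S) (hS : ∀ t ∈ S, D t ∈ adjoin K S)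
    {g : E} (hg : g ∈ adjoin K S) : D g ∈ adjoin K S := by
  induction hg using adjoin_induction with
  | mem x hx => exact hS x hx
  | algebraMap x => exact hK x
  | add x y _ _ hx hy => rw [map_add]; exact add_mem hx hy
  | inv x hx' hx =>
    rw [Derivation.leibniz_inv, smul_eq_mul]
    exact mul_mem (neg_mem (pow_mem (inv_mem hx') 2)) hx
  | mul x y hx' hy' hx hy =>
    rw [Derivation.leibniz, smul_eq_mul, smul_eq_mul]
    exact add_mem (mul_mem hx' hy) (mul_mem hy' hx)

end PrimitiveExtension

section Heisenberg

variable {E : Type*} [Field E] [CharZero E] {D : Derivation ℚ E E} {F : Subfield E}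
  {f₁ f₂ r x₁ x₂ y : E}

/-- An element of `K(t)` whose derivative is `u * t + v` is a polynomial of degree `≤ 2`
in the primitive `t`; this lists the resulting conditions on its coefficients. -/
theorem exists_coeffs_of_derivation_eq_linear {K : Type*} [Field K] [Algebra K E]
    (hK : ∀ a : K, ∃ b : K, D (algebraMap K E a) = algebraMap K E b) {t : E} {a : K}
    (ht : D t = algebraMap K E a) (htr : Transcendental K t)
    (ha : ∀ b : K, D (algebraMap K E b) ≠ D t) {g : E} (hg : g ∈ K⟮t⟯) {u v : K}
    (hs : D g = algebraMap K E u * t + algebraMap K E v) :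
    ∃ p₀ p₁ p₂ : K, D (algebraMap K E p₂) = 0 ∧
      algebraMap K E u = D (algebraMap K E p₁) + 2 * algebraMap K E p₂ * D t ∧
      algebraMap K E v = D (algebraMap K E p₀) + algebraMap K E p₁ * D t := by
  obtain ⟨p, -, hp, hcoeff⟩ := exists_polynomial_of_derivation_eq_aeval hK ht htr ha hg
    (s := C u * X + C v) (m := 2) (by simpa using hs) (fun n hn => by
      rw [coeff_add, coeff_C_mul, coeff_X_of_ne_one (by lia), coeff_C_of_ne_zero (by lia)]
      simp)
  refine ⟨p.coeff 0, p.coeff 1, p.coeff 2, ?_, ?_, ?_⟩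
  · have h := hcoeff 2
    rw [coeff_eq_zero_of_natDegree_lt (show p.natDegree < 2 + 1 by lia)] at h
    simpa [coeff_X, coeff_C] using h.symm
  · have h := hcoeff 1
    norm_num [coeff_X, coeff_C] at h
    exact h
  · simpa using hcoeff 0

/-- The differential field `F(x₁, x₂, y)` has no constants outside `F`. -/
theorem mem_of_derivation_eq_zero (hF : ∀ a ∈ F, D a ∈ F)
    (hf₁ : f₁ ∈ F) (hf₂ : f₂ ∈ F) (hr : r ∈ F)
    (hcondC : ∀ c₁ c₂ g : E, c₁ ∈ F → D c₁ = 0 → c₂ ∈ F → D c₂ = 0 → g ∈ F →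
      c₁ * f₁ + c₂ * f₂ = D g → c₁ = 0 ∧ c₂ = 0)
    (hind : AlgebraicIndependent F ![x₁, x₂, y])
    (h1 : D x₁ = f₁) (h2 : D x₂ = f₂) (h3 : D y = f₁ * x₂ + r)
    {g : E} (hg : g ∈ adjoin F {x₁, x₂, y}) (hDg : D g = 0) : g ∈ F := by
  have htr₁ : Transcendental F x₁ := hind.transcendental 0
  have htr₂ : Transcendental F⟮x₁⟯ x₂ := by
    have h := hind.transcendental_adjoin (s := {0}) (i := 1) (by simp)
    rw [show ![x₁, x₂, y] '' {0} = {x₁} by simp, ← transcendental_adjoin_iff] at h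
    exact h
  have htr₃ : Transcendental (adjoin F {x₁, x₂}) y := by
    have h := hind.transcendental_adjoin (s := {0, 1}) (i := 2) (by simp)
    rw [show ![x₁, x₂, y] '' {0, 1} = {x₁, x₂} by simp [Set.image_pair],
      ← transcendental_adjoin_iff] at h
    exact h
  have hK₀ : ∀ a : F, ∃ b : F, D (algebraMap F E a) = algebraMap F E b :=
    fun a => ⟨⟨_, hF a a.2⟩, rfl⟩
  have stable : ∀ S : Set E, (∀ t ∈ S, D t ∈ adjoin F S) →
      ∀ a : adjoin F S, ∃ b : adjoin F S,
        D (algebraMap (adjoin F S) E a) = algebraMap (adjoin F S) E b :=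
    fun S hS a => ⟨⟨_, derivation_mem_adjoin
      (fun c : F => _root_.algebraMap_mem (adjoin F S) (⟨_, hF c c.2⟩ : F)) hS a.2⟩, rfl⟩
  have mem_of : ∀ (S : Set E) {a : E}, a ∈ F → a ∈ adjoin F S :=
    fun S a ha => _root_.algebraMap_mem (adjoin F S) (⟨a, ha⟩ : F)
  have hK₁ := stable {x₁} (by
    rintro t rfl
    exact h1 ▸ mem_of _ hf₁)
  have hK₂ := stable {x₁, x₂} (by
    rintro t (rfl | rfl)
    · exact h1 ▸ mem_of _ hf₁
    · exact h2 ▸ mem_of _ hf₂)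
  have ht₁ : D x₁ = algebraMap F E ⟨f₁, hf₁⟩ := h1
  have ht₂ : D x₂ = algebraMap F⟮x₁⟯ E ⟨f₂, mem_of _ hf₂⟩ := h2
  have ht₃ : D y = algebraMap (adjoin F {x₁, x₂}) E ⟨f₁ * x₂ + r,
      add_mem (mul_mem (mem_of _ hf₁) (subset_adjoin _ _ (by simp))) (mem_of _ hr)⟩ := h3
  have mem₂ : ∀ {a : E}, a ∈ adjoin F {x₁, x₂} → a ∈ adjoin F⟮x₁⟯ {x₂} := by
    intro a ha
    rw [← mem_restrictScalars F, adjoin_adjoin_left, Set.singleton_union]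
    exact ha
  have mem₃ : g ∈ adjoin (adjoin F {x₁, x₂}) {y} := by
    rw [← mem_restrictScalars F, adjoin_adjoin_left, Set.insert_union, Set.singleton_union]
    exact hg
  have ha₁ : ∀ b : F, D (algebraMap F E b) ≠ D x₁ := by
    intro b hb
    refine one_ne_zero (hcondC 1 0 b (one_mem _) (by simp) (zero_mem _) (by simp) b.2 ?_).1
    change D (b : E) = _ at hb
    rw [hb, h1]
    ring
  have const₁ : ∀ c ∈ F⟮x₁⟯, D c = 0 → c ∈ F := by
    intro c hc hDc
    obtain ⟨b, rfl⟩ := exists_eq_algebraMap_of_derivation_eq_zero hK₀ ht₁ htr₁ ha₁ hc hDc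
    exact b.2
  have ha₂ : ∀ b : F⟮x₁⟯, D (algebraMap F⟮x₁⟯ E b) ≠ D x₂ := by
    intro b hb
    obtain ⟨c, h, hDc, hbch⟩ := exists_eq_mul_add_of_derivation_eq_algebraMap hK₀ ht₁ htr₁ ha₁ b.2
      (s := ⟨f₂, hf₂⟩) (hb.trans h2)
    change D (b : E) = _ at hb
    change D (c : E) = 0 at hDc
    change (b : E) = c * x₁ + h at hbch
    rw [hbch, map_add, Derivation.leibniz, hDc, h1, h2, smul_eq_mul, smul_zero, add_zero] at hb
    refine one_ne_zero (hcondC (-c) 1 h (neg_mem c.2) (by simp [hDc]) (one_mem _) (by simp)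
      h.2 ?_).2
    linear_combination -hb
  have ha₃ : ∀ b : adjoin F {x₁, x₂}, D (algebraMap (adjoin F {x₁, x₂}) E b) ≠ D y := by
    intro b hb
    obtain ⟨p₀, p₁, p₂, hp₂, hu, hv⟩ := exists_coeffs_of_derivation_eq_linear hK₁ ht₂ htr₂ ha₂
      (mem₂ b.2) (u := ⟨f₁, mem_of _ hf₁⟩) (v := ⟨r, mem_of _ hr⟩) (hb.trans h3)
    change D (p₂ : E) = 0 at hp₂
    change f₁ = D (p₁ : E) + 2 * p₂ * D x₂ at hu
    change r = D (p₀ : E) + p₁ * D x₂ at hv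
    rw [h2] at hu hv
    have hp₂F : (p₂ : E) ∈ F := const₁ _ p₂.2 hp₂
    have hDtwo : D (2 : E) = 0 := mod_cast D.map_natCast 2
    have htwo : (2 : E) ∈ F := ofNat_mem F 2
    obtain ⟨c, h, hDc, hp₁⟩ := exists_eq_mul_add_of_derivation_eq_algebraMap hK₀ ht₁ htr₁ ha₁ p₁.2
      (s := ⟨f₁ - 2 * p₂ * f₂, sub_mem hf₁ (mul_mem (mul_mem htwo hp₂F) hf₂)⟩)
      (show D (p₁ : E) = f₁ - 2 * p₂ * f₂ by linear_combination -hu)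
    change D (c : E) = 0 at hDc
    change (p₁ : E) = c * x₁ + h at hp₁
    rw [hp₁, map_add, Derivation.leibniz, hDc, h1, smul_eq_mul, smul_zero, add_zero] at hu
    have hc : (1 : E) - c = 0 :=
      (hcondC (1 - c) (-(2 * p₂)) h (sub_mem (one_mem _) c.2) (by simp [hDc])
        (neg_mem (mul_mem htwo hp₂F)) (by simp [Derivation.leibniz, hp₂, hDtwo]) h.2
        (by linear_combination hu)).1
    obtain ⟨q₀, q₁, q₂, hq₂, hu', -⟩ := exists_coeffs_of_derivation_eq_linear hK₀ ht₁ htr₁ ha₁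
      p₀.2 (u := ⟨-f₂, neg_mem hf₂⟩) (v := ⟨r - h * f₂, sub_mem hr (mul_mem h.2 hf₂)⟩)
      (show D (p₀ : E) = -f₂ * x₁ + (r - h * f₂) by
        linear_combination -hv - f₂ * hp₁ + f₂ * x₁ * hc)
    change D (q₂ : E) = 0 at hq₂
    change -f₂ = D (q₁ : E) + 2 * q₂ * D x₁ at hu'
    rw [h1] at hu'
    refine one_ne_zero (hcondC (2 * q₂) 1 (-q₁) (mul_mem htwo q₂.2)
      (by simp [Derivation.leibniz, hq₂, hDtwo]) (one_mem _) (by simp) (neg_mem q₁.2) ?_).2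
    rw [map_neg]
    linear_combination -hu'
  obtain ⟨b, rfl⟩ := exists_eq_algebraMap_of_derivation_eq_zero hK₂ ht₃ htr₃ ha₃ mem₃ hDg
  obtain ⟨c, hc⟩ := exists_eq_algebraMap_of_derivation_eq_zero hK₁ ht₂ htr₂ ha₂ (mem₂ b.2) hDg
  exact const₁ _ (show (b : E) ∈ F⟮x₁⟯ from hc ▸ c.2) hDg

/-- Two algebraically independent generating families of a field extension with the same index type
are related by an automorphism. -/
theorem exists_algEquiv_apply_eq {ι F E : Type*} [Field F] [Field E] [Algebra F E] {x v : ι → E}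
    (hx : AlgebraicIndependent F x) (hv : AlgebraicIndependent F v)
    (hx_top : adjoin F (Set.range x) = ⊤) (hv_top : adjoin F (Set.range v) = ⊤) :
    ∃ σ : E ≃ₐ[F] E, ∀ i, σ (x i) = v i := by
  have key : ∀ w : ι → E, AlgebraicIndependent F w → adjoin F (Set.range w) = ⊤ →
      ∃ e : FractionRing (MvPolynomial ι F) ≃ₐ[F] E,
        ∀ i, e (algebraMap (MvPolynomial ι F) _ (MvPolynomial.X i)) = w i := by
    intro w hw hw_top
    refine ⟨hw.aevalEquivField.trans ((equivOfEq hw_top).trans topEquiv), fun i => ?_⟩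
    have h := hw.aevalEquivField_algebraMap_apply_coe (MvPolynomial.X i)
    rw [MvPolynomial.aeval_X] at h
    exact h
  obtain ⟨e, he⟩ := key x hx hx_top
  obtain ⟨ev, hev⟩ := key v hv hv_top
  refine ⟨e.symm.trans ev, fun i => ?_⟩
  rw [AlgEquiv.trans_apply, ← he i, e.symm_apply_apply, hev]

/-- Algebraic independence is preserved by unitriangular affine substitutions. -/
theorem algebraicIndependent_heisenberg_translate {F E : Type*} [Field F] [Field E] [Algebra F E]
    {x₁ x₂ y : E} (hind : AlgebraicIndependent F ![x₁, x₂, y]) (α β ρ : F) :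
    AlgebraicIndependent F ![x₁ + algebraMap F E α, x₂ + algebraMap F E β,
      y + algebraMap F E β * x₁ + algebraMap F E ρ] := by
  let shift (α β ρ : F) : MvPolynomial (Fin 3) F →ₐ[F] MvPolynomial (Fin 3) F :=
    MvPolynomial.aeval ![.X 0 + .C α, .X 1 + .C β, .X 2 + .C β * .X 0 + .C ρ]
  have hleft : (shift (-α) (-β) (α * β - ρ)).comp (shift α β ρ) = AlgHom.id F _ := by
    apply MvPolynomial.algHom_ext
    intro i
    fin_cases i <;> simp [shift, MvPolynomial.algHom_C, MvPolynomial.algebraMap_eq]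
    ring
  have hinj : Function.Injective (shift α β ρ) :=
    Function.LeftInverse.injective (g := shift (-α) (-β) (α * β - ρ)) (DFunLike.congr_fun hleft)
  have hcomp : MvPolynomial.aeval ![x₁ + algebraMap F E α, x₂ + algebraMap F E β,
      y + algebraMap F E β * x₁ + algebraMap F E ρ] =
      (MvPolynomial.aeval ![x₁, x₂, y]).comp (shift α β ρ) := by
    apply MvPolynomial.algHom_ext
    intro i
    fin_cases i <;> simp [shift]
  rw [algebraicIndependent_iff_injective_aeval, hcomp]
  exact (algebraicIndependent_iff_injective_aeval.mp hind).comp hinj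

theorem adjoin_eq_top_of_closure_eq_top {E : Type*} [Field E] {F : Subfield E} {S : Set E}
    (hgen : Subfield.closure (↑F ∪ S) = ⊤) : adjoin F S = ⊤ := by
  rw [eq_top_iff]
  intro a _
  have ha : a ∈ Subfield.closure (↑F ∪ S) := hgen ▸ Subfield.mem_top a
  refine (Subfield.closure_le (t := (adjoin F S).toSubfield)).mpr ?_ ha
  rintro b (hb | hb)
  · exact _root_.algebraMap_mem (adjoin F S) (⟨b, hb⟩ : F)
  · exact subset_adjoin _ _ hb

/-- A ring endomorphism fixing `F` commutes with `D` as soon as it does so on generators. -/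
theorem map_derivation_of_closure_eq_top {S : Set E} (hF : ∀ a ∈ F, D a ∈ F)
    (hgen : Subfield.closure (↑F ∪ S) = ⊤) {σ : E →+* E} (hσ : ∀ a ∈ F, σ a = a)
    (hS : ∀ a ∈ S, σ (D a) = D (σ a)) (a : E) : σ (D a) = D (σ a) := by
  have ha : a ∈ Subfield.closure (↑F ∪ S) := hgen ▸ Subfield.mem_top a
  induction ha using Subfield.closure_induction with
  | mem x hx =>
    rcases hx with hx | hx
    · rw [hσ x hx, hσ _ (hF x hx)]
    · exact hS x hx
  | one => simp
  | add x y _ _ hx hy => simp only [map_add, hx, hy]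
  | neg x _ hx => simp only [map_neg, hx]
  | inv x _ hx =>
    simp only [Derivation.leibniz_inv, smul_eq_mul, map_mul, map_neg, map_pow, map_inv₀, hx]
  | mul x y _ _ hx hy => simp only [Derivation.leibniz, smul_eq_mul, map_add, map_mul, hx, hy]

/-- Existence of the automorphism with prescribed constants. -/
theorem exists_ringAut_heisenberg (hF : ∀ a ∈ F, D a ∈ F)
    (hf₁ : f₁ ∈ F) (hf₂ : f₂ ∈ F) (hr : r ∈ F)
    (hind : AlgebraicIndependent F ![x₁, x₂, y])
    (h1 : D x₁ = f₁) (h2 : D x₂ = f₂) (h3 : D y = f₁ * x₂ + r)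
    (hgen : Subfield.closure (↑F ∪ {x₁, x₂, y}) = ⊤) {α β ρ : E}
    (hα : α ∈ F) (hDα : D α = 0) (hβ : β ∈ F) (hDβ : D β = 0) (hρ : ρ ∈ F) (hDρ : D ρ = 0) :
    ∃ σ : RingAut E, ((∀ a ∈ F, σ a = a) ∧ ∀ a, σ (D a) = D (σ a)) ∧
      σ x₁ = x₁ + α ∧ σ x₂ = x₂ + β ∧ σ y = y + β * x₁ + ρ := by
  have hx_top : adjoin F (Set.range ![x₁, x₂, y]) = ⊤ := by
    apply adjoin_eq_top_of_closure_eq_top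
    rwa [Matrix.range_cons, Matrix.range_cons, Matrix.range_cons, Matrix.range_empty,
      Set.union_empty, Set.singleton_union, Set.singleton_union]
  set v : Fin 3 → E := ![x₁ + α, x₂ + β, y + β * x₁ + ρ] with hv_def
  have hv : AlgebraicIndependent F v :=
    algebraicIndependent_heisenberg_translate hind ⟨α, hα⟩ ⟨β, hβ⟩ ⟨ρ, hρ⟩
  have hv_top : adjoin F (Set.range v) = ⊤ := by
    rw [eq_top_iff, ← hx_top, adjoin_le_iff]
    have hmem : ∀ i, v i ∈ adjoin F (Set.range v) := fun i => subset_adjoin _ _ ⟨i, rfl⟩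
    have hFmem : ∀ {a : E}, a ∈ F → a ∈ adjoin F (Set.range v) :=
      fun {a} ha => _root_.algebraMap_mem (adjoin F (Set.range v)) (⟨a, ha⟩ : F)
    have hx₁ : x₁ ∈ adjoin F (Set.range v) := by
      simpa [hv_def] using sub_mem (hmem 0) (hFmem hα)
    rintro _ ⟨i, rfl⟩
    fin_cases i
    · exact hx₁
    · simpa [hv_def] using sub_mem (hmem 1) (hFmem hβ)
    · simpa [hv_def] using sub_mem (sub_mem (hmem 2) (hFmem hρ)) (mul_mem (hFmem hβ) hx₁)
  obtain ⟨σ, hσ⟩ := exists_algEquiv_apply_eq hind hv hx_top hv_top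
  have hσ₁ : σ x₁ = x₁ + α := hσ 0
  have hσ₂ : σ x₂ = x₂ + β := hσ 1
  have hσ₃ : σ y = y + β * x₁ + ρ := hσ 2
  have hσF : ∀ a ∈ F, σ a = a := fun a ha => σ.commutes (⟨a, ha⟩ : F)
  refine ⟨σ.toRingEquiv, ⟨hσF, ?_⟩, hσ₁, hσ₂, hσ₃⟩
  refine map_derivation_of_closure_eq_top (σ := (σ : E →+* E)) hF hgen hσF ?_
  rintro a (rfl | rfl | rfl)
  · change σ (D a) = D (σ a)
    rw [hσ₁, h1, map_add, h1, hDα, add_zero, hσF _ hf₁]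
  · change σ (D a) = D (σ a)
    rw [hσ₂, h2, map_add, h2, hDβ, add_zero, hσF _ hf₂]
  · change σ (D a) = D (σ a)
    rw [hσ₃, h3]
    simp only [map_add, map_mul, Derivation.leibniz, smul_eq_mul, h1, h3, hDβ, hDρ, hσ₂,
      hσF _ hf₁, hσF _ hr]
    ring

/-- Automorphisms over `F` agreeing on generators are equal. -/
theorem ringAut_ext_of_closure_eq_top {E : Type*} [Field E] {F : Subfield E} {S : Set E}
    (hgen : Subfield.closure (↑F ∪ S) = ⊤)
    {σ τ : RingAut E} (hF : ∀ a ∈ F, σ a = τ a) (hS : ∀ a ∈ S, σ a = τ a) : σ = τ := by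
  refine RingEquiv.ext fun a => ?_
  have heq : Set.EqOn (σ : E →+* E) (τ : E →+* E) (↑F ∪ S) := by
    rintro b (hb | hb)
    exacts [hF b hb, hS b hb]
  have ha : a ∈ Subfield.closure (↑F ∪ S) := hgen ▸ Subfield.mem_top a
  exact RingHom.eqOn_field_closure (f := (σ : E →+* E)) (g := (τ : E →+* E)) heq ha

end Heisenberg

/-- With `E = F(x₁, x₂, y)` as in the Heisenberg construction
(`f₁, f₂` satisfying condition (C), `x₁′ = f₁`, `x₂′ = f₂`, `y′ = f₁·x₂ + r`):
(1) every differential automorphism `σ` of `E` over `F` satisfies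
`σ(x₁) = x₁ + α`, `σ(x₂) = x₂ + β`, `σ(y) = y + β·x₁ + ρ` for unique constants
`α, β, ρ ∈ C`;  (2) conversely every such triple of constants arises from a unique
differential automorphism;  (3) consequently the differential Galois group is isomorphic
to the Heisenberg group `U(3, C)` of upper unitriangular `3 × 3` matrices with constant
entries, via `σ ↦ M_σ`. -/
theorem galois_group_heisenberg
    (E : Type) [Field E] [CharZero E] (D : Derivation ℚ E E)
    (F : Subfield E) (hF : ∀ a ∈ F, D a ∈ F)
    (f₁ f₂ r : E) (hf₁ : f₁ ∈ F) (hf₂ : f₂ ∈ F) (hr : r ∈ F)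
    (hcondC : ∀ c₁ c₂ g : E, c₁ ∈ F → D c₁ = 0 → c₂ ∈ F → D c₂ = 0 → g ∈ F →
      c₁ * f₁ + c₂ * f₂ = D g → c₁ = 0 ∧ c₂ = 0)
    (x₁ x₂ y : E) (hind : AlgebraicIndependent F ![x₁, x₂, y])
    (h1 : D x₁ = f₁) (h2 : D x₂ = f₂) (h3 : D y = f₁ * x₂ + r)
    (hgen : Subfield.closure (↑F ∪ {x₁, x₂, y}) = ⊤) :
    (∀ σ : RingAut E, σ ∈ diffGal E D F →
      ∃! t : E × E × E,
        (t.1 ∈ F ∧ D t.1 = 0) ∧ (t.2.1 ∈ F ∧ D t.2.1 = 0) ∧ (t.2.2 ∈ F ∧ D t.2.2 = 0) ∧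
        σ x₁ = x₁ + t.1 ∧ σ x₂ = x₂ + t.2.1 ∧ σ y = y + t.2.1 * x₁ + t.2.2) ∧
    (∀ α β ρ : E, α ∈ F → D α = 0 → β ∈ F → D β = 0 → ρ ∈ F → D ρ = 0 →
      ∃! σ : RingAut E, σ ∈ diffGal E D F ∧
        σ x₁ = x₁ + α ∧ σ x₂ = x₂ + β ∧ σ y = y + β * x₁ + ρ) ∧
    (∃ Φ : diffGal E D F →* Matrix (Fin 3) (Fin 3) E,
      Function.Injective Φ ∧
      Set.range ⇑Φ = {M : Matrix (Fin 3) (Fin 3) E |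
        M 0 0 = 1 ∧ M 1 1 = 1 ∧ M 2 2 = 1 ∧
        M 1 0 = 0 ∧ M 2 0 = 0 ∧ M 2 1 = 0 ∧
        (M 0 1 ∈ F ∧ D (M 0 1) = 0) ∧ (M 0 2 ∈ F ∧ D (M 0 2) = 0) ∧
        (M 1 2 ∈ F ∧ D (M 1 2) = 0)} ∧
      ∀ σ : diffGal E D F,
        (σ : RingAut E) x₁ = x₁ + Φ σ 0 1 ∧
        (σ : RingAut E) x₂ = x₂ + Φ σ 1 2 ∧
        (σ : RingAut E) y = y + Φ σ 1 2 * x₁ + Φ σ 0 2) := by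
  have htop : adjoin F {x₁, x₂, y} = ⊤ := adjoin_eq_top_of_closure_eq_top hgen
  have const : ∀ c, D c = 0 → c ∈ F := fun c hc =>
    mem_of_derivation_eq_zero hF hf₁ hf₂ hr hcondC hind h1 h2 h3 (htop ▸ mem_top) hc
  have ext : ∀ σ ∈ diffGal E D F, ∀ τ ∈ diffGal E D F,
      σ x₁ = τ x₁ → σ x₂ = τ x₂ → σ y = τ y → σ = τ := by
    intro σ hσ τ hτ e₁ e₂ e₃
    refine ringAut_ext_of_closure_eq_top hgen (fun a ha => (hσ.1 a ha).trans (hτ.1 a ha).symm) ?_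
    rintro a (rfl | rfl | rfl)
    exacts [e₁, e₂, e₃]
  have translation : ∀ σ ∈ diffGal E D F, ∃ α β ρ : E, D α = 0 ∧ D β = 0 ∧ D ρ = 0 ∧
      σ x₁ = x₁ + α ∧ σ x₂ = x₂ + β ∧ σ y = y + β * x₁ + ρ := by
    rintro σ ⟨hσF, hσD⟩
    have hα : D (σ x₁ - x₁) = 0 := by rw [map_sub, ← hσD, h1, hσF _ hf₁, sub_self]
    have hβ : D (σ x₂ - x₂) = 0 := by rw [map_sub, ← hσD, h2, hσF _ hf₂, sub_self]
    refine ⟨σ x₁ - x₁, σ x₂ - x₂, σ y - y - (σ x₂ - x₂) * x₁, hα, hβ, ?_, by ring, by ring,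
      by ring⟩
    rw [map_sub, map_sub, Derivation.leibniz, hβ, ← hσD, h1, h3, map_add, map_mul, hσF _ hf₁,
      hσF _ hr, smul_eq_mul, smul_zero]
    ring
  have existence : ∀ α β ρ : E, D α = 0 → D β = 0 → D ρ = 0 → ∃ σ ∈ diffGal E D F,
      σ x₁ = x₁ + α ∧ σ x₂ = x₂ + β ∧ σ y = y + β * x₁ + ρ := fun α β ρ hα hβ hρ =>
    exists_ringAut_heisenberg hF hf₁ hf₂ hr hind h1 h2 h3 hgen
      (const α hα) hα (const β hβ) hβ (const ρ hρ) hρ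
  refine ⟨?_, ?_, ?_⟩
  · intro σ hσ
    obtain ⟨α, β, ρ, hα, hβ, hρ, e₁, e₂, e₃⟩ := translation σ hσ
    refine ⟨(α, β, ρ), ⟨⟨const α hα, hα⟩, ⟨const β hβ, hβ⟩, ⟨const ρ hρ, hρ⟩, e₁, e₂, e₃⟩, ?_⟩
    rintro ⟨α', β', ρ'⟩ ⟨-, -, -, e₁', e₂', e₃'⟩
    dsimp only at e₁' e₂' e₃'
    obtain rfl : α' = α := by linear_combination e₁ - e₁'
    obtain rfl : β' = β := by linear_combination e₂ - e₂'
    obtain rfl : ρ' = ρ := by linear_combination e₃ - e₃'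
    rfl
  · intro α β ρ _ hα _ hβ _ hρ
    obtain ⟨σ, hσ, e₁, e₂, e₃⟩ := existence α β ρ hα hβ hρ
    refine ⟨σ, ⟨hσ, e₁, e₂, e₃⟩, ?_⟩
    rintro τ ⟨hτ, e₁', e₂', e₃'⟩
    exact ext τ hτ σ hσ (e₁'.trans e₁.symm) (e₂'.trans e₂.symm) (e₃'.trans e₃.symm)
  · choose a b c ha hb hc e₁ e₂ e₃ using fun σ : diffGal E D F => translation σ σ.2
    have aux : ∀ σ : diffGal E D F, ∀ α β ρ : E, (σ : RingAut E) x₁ = x₁ + α →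
        (σ : RingAut E) x₂ = x₂ + β → (σ : RingAut E) y = y + β * x₁ + ρ →
        a σ = α ∧ b σ = β ∧ c σ = ρ := by
      intro σ α β ρ e₁' e₂' e₃'
      have hbβ : b σ = β := by linear_combination e₂' - e₂ σ
      exact ⟨by linear_combination e₁' - e₁ σ, hbβ,
        by linear_combination e₃' - e₃ σ - x₁ * hbβ⟩
    have map_one : a 1 = 0 ∧ b 1 = 0 ∧ c 1 = 0 :=
      aux 1 0 0 0 (by simp) (by simp) (by simp)
    have map_mul : ∀ σ τ : diffGal E D F,
        a (σ * τ) = a σ + a τ ∧ b (σ * τ) = b σ + b τ ∧ c (σ * τ) = c τ + a σ * b τ + c σ := by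
      intro σ τ
      have fixed : ∀ d, D d = 0 → (σ : RingAut E) d = d := fun d hd => σ.2.1 d (const d hd)
      apply aux
      · change (σ : RingAut E) ((τ : RingAut E) x₁) = _
        rw [e₁ τ, map_add, e₁ σ, fixed _ (ha τ)]
        ring
      · change (σ : RingAut E) ((τ : RingAut E) x₂) = _
        rw [e₂ τ, map_add, e₂ σ, fixed _ (hb τ)]
        ring
      · change (σ : RingAut E) ((τ : RingAut E) y) = _
        rw [e₃ τ, map_add, map_add, _root_.map_mul, e₃ σ, e₁ σ, fixed _ (hb τ), fixed _ (hc τ)]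
        ring
    let Φ : diffGal E D F →* Matrix (Fin 3) (Fin 3) E :=
      { toFun := fun σ => !![1, a σ, c σ; 0, 1, b σ; 0, 0, 1]
        map_one' := by
          rw [map_one.1, map_one.2.1, map_one.2.2, Matrix.one_fin_three]
        map_mul' := fun σ τ => by
          rw [(map_mul σ τ).1, (map_mul σ τ).2.1, (map_mul σ τ).2.2]
          ext i j
          fin_cases i <;> fin_cases j <;>
            simp [Matrix.mul_apply, Fin.sum_univ_three, add_comm] }
    have Φ_apply : ∀ σ, Φ σ = !![1, a σ, c σ; 0, 1, b σ; 0, 0, 1] := fun _ => rfl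
    refine ⟨Φ, fun σ τ hστ => ?_, ?_, fun σ => ⟨e₁ σ, e₂ σ, e₃ σ⟩⟩
    · have ha' : a σ = a τ := congrFun (congrFun hστ 0) 1
      have hb' : b σ = b τ := congrFun (congrFun hστ 1) 2
      have hc' : c σ = c τ := congrFun (congrFun hστ 0) 2
      exact Subtype.ext (ext σ σ.2 τ τ.2 (by rw [e₁, e₁, ha']) (by rw [e₂, e₂, hb'])
        (by rw [e₃, e₃, hb', hc']))
    · ext M
      constructor
      · rintro ⟨σ, rfl⟩
        exact ⟨rfl, rfl, rfl, rfl, rfl, rfl, ⟨const _ (ha σ), ha σ⟩, ⟨const _ (hc σ), hc σ⟩,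
          ⟨const _ (hb σ), hb σ⟩⟩
      · rintro ⟨m₀₀, m₁₁, m₂₂, m₁₀, m₂₀, m₂₁, ⟨-, m₀₁⟩, ⟨-, m₀₂⟩, ⟨-, m₁₂⟩⟩
        obtain ⟨σ, hσ, e₁', e₂', e₃'⟩ := existence _ _ _ m₀₁ m₁₂ m₀₂
        obtain ⟨ha', hb', hc'⟩ := aux ⟨σ, hσ⟩ _ _ _ e₁' e₂' e₃'
        refine ⟨⟨σ, hσ⟩, ?_⟩
        rw [Φ_apply, ha', hb', hc']
        refine Eq.trans ?_ (Matrix.eta_fin_three M).symm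
        rw [m₀₀, m₁₁, m₂₂, m₁₀, m₂₀, m₂₁]
end

section
/- Let F be a differential field of characteristic zero with field of constants C, let f₁, …, fₙ ∈ F satisfy condition (C), and let F ⊆ E be an extension of differential fields with E = F(x_{i,j} : 1 ≤ i ≤ n, 1 ≤ j ≤ n+1−i), where the x_{i,j} are algebraically independent over F and x_{1,j}′ = f_j, x_{i,j}′ = f_j · x_{i−1, j+1} for 2 ≤ i ≤ n. Then for each pair (i,j), the smallest differential subfield of E containing F and x_{i,j} equals the subfield F(x_{1, i+j−1}, x_{2, i+j−2}, …, x_{i−1, j+1}, x_{i,j}) generated over F by the listed elements. In particular, E is the smallest differential subfield of E containing F and x_{1,1}, x_{2,1}, …, x_{n,1}. -/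
/-- A subfield generated by a set is closed under a derivation as soon as the derivation maps
the generators into it. -/
theorem Subfield.derivation_mem_closure {E : Type*} [Field E] [CharZero E]
    (D : Derivation ℚ E E) {S : Set E} (hS : ∀ a ∈ S, D a ∈ Subfield.closure S) {a : E}
    (ha : a ∈ Subfield.closure S) : D a ∈ Subfield.closure S := by
  induction ha using Subfield.closure_induction with
  | mem a ha => exact hS a ha
  | one => simp
  | add a b _ _ iha ihb => simpa using add_mem iha ihb
  | neg a _ iha => simpa using iha
  | inv a ha iha =>
    rw [Derivation.leibniz_inv, smul_eq_mul]
    exact mul_mem (neg_mem (pow_mem (inv_mem ha) 2)) iha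
  | mul a b ha hb iha ihb =>
    rw [Derivation.leibniz, smul_eq_mul, smul_eq_mul]
    exact add_mem (mul_mem ha ihb) (mul_mem hb iha)

/-- A differential subfield containing `x i j` and the nonzero elements `f j` contains the
whole antidiagonal chain below `x i j`. -/
theorem Subfield.chain_mem_of_derivation_mem {E : Type*} [Field E] [CharZero E]
    (D : Derivation ℚ E E) (K : Subfield E) (hK : ∀ a ∈ K, D a ∈ K)
    {n : ℕ} {f : ℕ → E} (hf : ∀ j, 1 ≤ j → j ≤ n → f j ∈ K)
    (hf0 : ∀ j, 1 ≤ j → j ≤ n → f j ≠ 0) {x : ℕ → ℕ → E}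
    (hdi : ∀ i j, 2 ≤ i → 1 ≤ j → i + j ≤ n + 1 → D (x i j) = f j * x (i - 1) (j + 1))
    {i j : ℕ} (hj : 1 ≤ j) (hij : i + j ≤ n + 1) (hx : x i j ∈ K) {t : ℕ} (ht : 1 ≤ t)
    (hti : t ≤ i) : x t (i + j - t) ∈ K := by
  induction hti using Nat.decreasingInduction with
  | self => simpa using hx
  | of_succ t hti ih =>
    have h := hdi (t + 1) (i + j - (t + 1)) (by omega) (by omega) (by omega)
    rw [Nat.add_sub_cancel, show i + j - (t + 1) + 1 = i + j - t by omega] at h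
    rw [(eq_inv_mul_iff_mul_eq₀ (hf0 _ (by omega) (by omega))).2 h.symm]
    exact mul_mem (inv_mem (hf _ (by omega) (by omega))) (hK _ (ih (by omega)))

/-- The smallest differential subfield of `E` (with respect to the derivation `D`)
containing the subfield `F` and the set `S`; written `F⟨S⟩` in the paper. -/
def diffAdjoin (E : Type) [Field E] [CharZero E] (D : Derivation ℚ E E)
    (F : Subfield E) (S : Set E) : Subfield E :=
  sInf {K : Subfield E | F ≤ K ∧ S ⊆ K ∧ ∀ a ∈ K, D a ∈ K}

/-- In the extension `E = F(x_{i,j})` built from `f₁, …, fₙ`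
satisfying condition (C), the smallest differential subfield `F⟨x_{i,j}⟩` of `E`
containing `F` and `x_{i,j}` equals `F(x_{1,i+j−1}, x_{2,i+j−2}, …, x_{i,j})`.
In particular `E = F⟨x_{1,1}, x_{2,1}, …, x_{n,1}⟩`. -/
theorem diffAdjoin_eq_adjoin_chain
    (E : Type) [Field E] [CharZero E] (D : Derivation ℚ E E)
    (F : Subfield E) (hF : ∀ a ∈ F, D a ∈ F)
    (n : ℕ) (f : ℕ → E) (hf : ∀ j, 1 ≤ j → j ≤ n → f j ∈ F)
    (hcondC : ∀ (c : ℕ → E) (g : E),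
      (∀ j, 1 ≤ j → j ≤ n → c j ∈ F ∧ D (c j) = 0) → g ∈ F →
      (∑ j ∈ Finset.Icc 1 n, c j * f j) = D g → ∀ j, 1 ≤ j → j ≤ n → c j = 0)
    (x : ℕ → ℕ → E)
    (hind : AlgebraicIndependent F
      (fun p : {p : ℕ × ℕ // 1 ≤ p.1 ∧ 1 ≤ p.2 ∧ p.1 + p.2 ≤ n + 1} => x p.1.1 p.1.2))
    (hgen : Subfield.closure
      (↑F ∪ {a | ∃ i j, 1 ≤ i ∧ 1 ≤ j ∧ i + j ≤ n + 1 ∧ a = x i j}) = ⊤)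
    (hd1 : ∀ j, 1 ≤ j → j ≤ n → D (x 1 j) = f j)
    (hdi : ∀ i j, 2 ≤ i → 1 ≤ j → i + j ≤ n + 1 → D (x i j) = f j * x (i - 1) (j + 1)) :
    (∀ i j, 1 ≤ i → 1 ≤ j → i + j ≤ n + 1 →
      diffAdjoin E D F {x i j} =
        Subfield.closure (↑F ∪ {a | ∃ t, 1 ≤ t ∧ t ≤ i ∧ a = x t (i + j - t)})) ∧
    diffAdjoin E D F {a | ∃ i, 1 ≤ i ∧ i ≤ n ∧ a = x i 1} = ⊤ := by
  have hf0 : ∀ j, 1 ≤ j → j ≤ n → f j ≠ 0 := by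
    intro j hj hjn h0
    have h := hcondC (Pi.single j 1) 0 (fun k _ _ => ?_) F.zero_mem ?_ j hj hjn
    · simp at h
    · rcases eq_or_ne k j with rfl | hk
      · simp
      · simp [hk]
    · rw [map_zero]
      refine Finset.sum_eq_zero fun k _ => ?_
      rcases eq_or_ne k j with rfl | hk
      · simp [h0]
      · simp [hk]
  refine ⟨fun i j hi hj hij => le_antisymm (sInf_le ⟨?_, ?_, ?_⟩) (le_sInf ?_), ?_⟩
  · exact fun a ha => Subfield.subset_closure (Or.inl ha)
  · rintro _ rfl
    exact Subfield.subset_closure (Or.inr ⟨i, hi, le_rfl, by simp⟩)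
  · refine fun a ha => Subfield.derivation_mem_closure D ?_ ha
    rintro a (ha | ⟨t, ht, hti, rfl⟩)
    · exact Subfield.subset_closure (Or.inl (hF a ha))
    · have hfm := hf (i + j - t) (by omega) (by omega)
      rcases ht.eq_or_lt with rfl | ht
      · rw [hd1 _ (by omega) (by omega)]
        exact Subfield.subset_closure (Or.inl hfm)
      · rw [hdi _ _ ht (by omega) (by omega)]
        exact mul_mem (Subfield.subset_closure (Or.inl hfm)) (Subfield.subset_closure
          (Or.inr ⟨t - 1, by omega, by omega, by congr 1; omega⟩))
  · rintro K ⟨hFK, hxK, hK⟩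
    rw [Subfield.closure_le]
    rintro a (ha | ⟨t, ht, hti, rfl⟩)
    · exact hFK ha
    · exact K.chain_mem_of_derivation_mem D hK (fun j h h' => hFK (hf j h h')) hf0 hdi hj hij
        (hxK rfl) ht hti
  · rw [eq_top_iff, ← hgen]
    refine le_sInf ?_
    rintro K ⟨hFK, hxK, hK⟩
    rw [Subfield.closure_le]
    rintro a (ha | ⟨i, j, hi, hj, hij, rfl⟩)
    · exact hFK ha
    · have h := K.chain_mem_of_derivation_mem D hK (fun j h h' => hFK (hf j h h')) hf0 hdi
        le_rfl (i := i + j - 1) (by omega) (hxK ⟨_, by omega, by omega, rfl⟩) hi (by omega)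
      rwa [show i + j - 1 + 1 - i = j by omega] at h
end
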